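/- There is an absolute constant C > 0 such that for every prime p and every symmetric proper generalized arithmetic progression A ⊆ F_p of rank 2, the multiplicative energy satisfies E_×(A) ≤ C · (|A|² + |A|⁴/p) · log p. -/

import Mathlib

open Finset

/-- The multiplicative energy of a finite subset `S` of `F_p`:
the number of quadruples `(s₁, s₂, s₃, s₄) ∈ S⁴` with `s₁s₂ = s₃s₄`. -/
def multEnergy {p : ℕ} (S : Finset (ZMod p)) : ℕ :=
  (((S ×ˢ S) ×ˢ (S ×ˢ S)).filter (fun q => q.1.1 * q.1.2 = q.2.1 * q.2.2)).card

/-! ### Size of residues -/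

/-- The distance of a residue class to `0`: the absolute value of its least absolute residue. -/
def absRes {p : ℕ} (x : ZMod p) : ℤ := |x.valMinAbs|

lemma absRes_nonneg {p : ℕ} (x : ZMod p) : 0 ≤ absRes x := abs_nonneg _

lemma absRes_intCast_le {p : ℕ} [NeZero p] (z : ℤ) : absRes (z : ZMod p) ≤ |z| := by
  have h := ZMod.natAbs_min_of_le_div_two p (z : ZMod p).valMinAbs z (ZMod.coe_valMinAbs _)
    (ZMod.natAbs_valMinAbs_le _)
  rw [absRes, Int.abs_eq_natAbs, Int.abs_eq_natAbs]
  exact_mod_cast h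

lemma absRes_intCast_eq {p : ℕ} [NeZero p] (z : ℤ) (hz : 2 * |z| < p) :
    absRes (z : ZMod p) = |z| := by
  apply le_antisymm (absRes_intCast_le z)
  have h := ZMod.natAbs_min_of_le_div_two p z (z : ZMod p).valMinAbs (ZMod.coe_valMinAbs _).symm
    (by rw [Int.abs_eq_natAbs] at hz; omega)
  rw [absRes, Int.abs_eq_natAbs, Int.abs_eq_natAbs]
  exact_mod_cast h

lemma absRes_add_le {p : ℕ} [NeZero p] (x y : ZMod p) :
    absRes (x + y) ≤ absRes x + absRes y := by
  have h := absRes_intCast_le (p := p) (x.valMinAbs + y.valMinAbs)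
  push_cast [ZMod.coe_valMinAbs] at h
  exact h.trans (abs_add_le _ _)

lemma absRes_neg {p : ℕ} (x : ZMod p) : absRes (-x) = absRes x := by
  rw [absRes, absRes, Int.abs_eq_natAbs, Int.abs_eq_natAbs, ZMod.natAbs_valMinAbs_neg]

lemma absRes_sub_le {p : ℕ} [NeZero p] (x y : ZMod p) :
    absRes (x - y) ≤ absRes x + absRes y := by
  rw [sub_eq_add_neg, ← absRes_neg y]
  exact absRes_add_le x (-y)

lemma absRes_mul_intCast_le {p : ℕ} [NeZero p] (x : ZMod p) (z : ℤ) :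
    absRes (x * (z : ZMod p)) ≤ absRes x * |z| := by
  have h := absRes_intCast_le (p := p) (x.valMinAbs * z)
  push_cast [ZMod.coe_valMinAbs] at h
  rwa [abs_mul] at h

lemma absRes_mul_intCast_eq {p : ℕ} [NeZero p] (x : ZMod p) (z : ℤ)
    (hz : 2 * (absRes x * |z|) < p) : absRes (x * (z : ZMod p)) = absRes x * |z| := by
  have h := absRes_intCast_eq (p := p) (x.valMinAbs * z) (by rw [abs_mul]; exact hz)
  push_cast [ZMod.coe_valMinAbs] at h
  rwa [abs_mul] at h

/-! ### Pigeonhole -/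

lemma abs_sub_lt_of_ediv_eq {a b m : ℤ} (hm : 0 < m) (h : a / m = b / m) : |a - b| < m := by
  have h1 := Int.mul_ediv_add_emod a m
  have h2 := Int.mul_ediv_add_emod b m
  have h3 := Int.emod_nonneg a hm.ne'
  have h4 := Int.emod_nonneg b hm.ne'
  have h5 := Int.emod_lt_of_pos a hm
  have h6 := Int.emod_lt_of_pos b hm
  rw [h] at h1
  rw [abs_lt]
  constructor <;> linarith

/-- The cell containing `z`, when `[-h, h]` is divided into `k` cells of equal length. -/
def cell (h k z : ℤ) : ℤ := (z + h) * k / (2 * h + 1)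

lemma cell_mem {h k z : ℤ} (hk : 0 < k) (hz : |z| ≤ h) : cell h k z ∈ Finset.Ico 0 k := by
  obtain ⟨h1, h2⟩ := abs_le.mp hz
  rw [Finset.mem_Ico]
  constructor
  · exact Int.ediv_nonneg (by nlinarith) (by linarith)
  · apply Int.ediv_lt_of_lt_mul (by linarith)
    nlinarith

lemma abs_sub_mul_le_of_cell_eq {h k z z' : ℤ} (hh : 0 ≤ h) (hk : 0 < k)
    (he : cell h k z = cell h k z') : |z - z'| * k ≤ 2 * h := by
  have := abs_sub_lt_of_ediv_eq (by linarith : 0 < 2 * h + 1) he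
  rw [show (z + h) * k - (z' + h) * k = (z - z') * k by ring, abs_mul, abs_of_pos hk] at this
  linarith

lemma exists_ne_abs_sub_mul_le {α : Type*} (S : Finset α) (f : α → ℤ) (h : ℤ) (k : ℕ)
    (hk : 0 < k) (hf : ∀ s ∈ S, |f s| ≤ h) (hc : k < S.card) :
    ∃ s ∈ S, ∃ s' ∈ S, s ≠ s' ∧ |f s - f s'| * k ≤ 2 * h := by
  have hk' : (0 : ℤ) < k := by exact_mod_cast hk
  obtain ⟨s, hs, s', hs', hne, he⟩ := Finset.exists_ne_map_eq_of_card_lt_of_maps_to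
    (s := S) (t := Finset.Ico (0 : ℤ) k) (by simpa using hc)
    (f := fun s => cell h k (f s)) (fun s hs => cell_mem hk' (hf s hs))
  exact ⟨s, hs, s', hs', hne,
    abs_sub_mul_le_of_cell_eq ((abs_nonneg _).trans (hf s hs)) hk' he⟩

lemma exists_ne_abs_sub_mul_le₂ {α : Type*} (S : Finset α) (f g : α → ℤ) (h h' : ℤ) (k : ℕ)
    (hk : 0 < k) (hf : ∀ s ∈ S, |f s| ≤ h) (hg : ∀ s ∈ S, |g s| ≤ h') (hc : k ^ 2 < S.card) :
    ∃ s ∈ S, ∃ s' ∈ S, s ≠ s' ∧ |f s - f s'| * k ≤ 2 * h ∧ |g s - g s'| * k ≤ 2 * h' := by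
  have hk' : (0 : ℤ) < k := by exact_mod_cast hk
  obtain ⟨s, hs, s', hs', hne, he⟩ := Finset.exists_ne_map_eq_of_card_lt_of_maps_to
    (s := S) (t := Finset.Ico (0 : ℤ) k ×ˢ Finset.Ico (0 : ℤ) k)
    (by rw [Finset.card_product]; simpa [sq] using hc)
    (f := fun s => (cell h k (f s), cell h' k (g s)))
    (fun s hs => Finset.mem_coe.mpr
      (Finset.mem_product.mpr ⟨cell_mem hk' (hf s hs), cell_mem hk' (hg s hs)⟩))
  rw [Prod.mk.injEq] at he
  exact ⟨s, hs, s', hs', hne,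
    abs_sub_mul_le_of_cell_eq ((abs_nonneg _).trans (hf s hs)) hk' he.1,
    abs_sub_mul_le_of_cell_eq ((abs_nonneg _).trans (hg s hs)) hk' he.2⟩

/-! ### From level sets to second moments -/

/-- If the level sets of `f` satisfy `#{f > k} ≤ X / (k + 1)²`, then the sum of `f²` is
bounded by `X` up to a logarithmic factor. -/
lemma sum_sq_le_of_card_level_le {α : Type*} (S : Finset α) (f : α → ℕ) (N : ℕ) (X : ℝ)
    (hN : ∀ s ∈ S, f s ≤ N)
    (hX : ∀ k : ℕ, ((S.filter (fun s => k < f s)).card : ℝ) * ((k : ℝ) + 1) ^ 2 ≤ X) :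
    ∑ s ∈ S, (f s : ℝ) ^ 2 ≤ 2 * X * (1 + Real.log N) := by
  have h1 : ∀ n : ℕ, ∑ k ∈ Finset.range n, (2 * (k : ℝ) + 1) = (n : ℝ) ^ 2 := by
    intro n
    induction n with
    | zero => simp
    | succ n ih => rw [Finset.sum_range_succ, ih]; push_cast; ring
  have h2 : ∀ s ∈ S, (f s : ℝ) ^ 2 =
      ∑ k ∈ Finset.range N, if k < f s then (2 * (k : ℝ) + 1) else 0 := by
    intro s hs
    rw [← h1, ← Finset.sum_filter]
    congr 1
    ext k
    have := hN s hs
    simp only [Finset.mem_range, Finset.mem_filter]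
    omega
  have hX0 : 0 ≤ X := le_trans (by positivity) (hX 0)
  rw [Finset.sum_congr rfl h2, Finset.sum_comm]
  calc ∑ k ∈ Finset.range N, ∑ s ∈ S, (if k < f s then (2 * (k : ℝ) + 1) else 0)
      ≤ ∑ k ∈ Finset.range N, 2 * X * ((k : ℝ) + 1)⁻¹ := by
        apply Finset.sum_le_sum
        intro k _
        rw [← Finset.sum_filter, Finset.sum_const, nsmul_eq_mul]
        have hk : (0 : ℝ) < (k : ℝ) + 1 := by positivity
        rw [← div_eq_mul_inv, le_div_iff₀ hk]
        have := hX k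
        have hc : (0 : ℝ) ≤ ((S.filter (fun s => k < f s)).card : ℝ) := by positivity
        nlinarith [mul_nonneg hc hk.le]
    _ = 2 * X * (harmonic N : ℝ) := by
        rw [← Finset.mul_sum, harmonic]
        push_cast
        rfl
    _ ≤ 2 * X * (1 + Real.log N) := by
        gcongr
        exact harmonic_le_one_add_log N

/-! ### Exponential sums -/

lemma half_le_re_stdAddChar {p : ℕ} [NeZero p] (x : ZMod p) (hx : 6 * absRes x ≤ p) :
    1 / 2 ≤ (ZMod.stdAddChar x : ℂ).re := by
  have hp : (0 : ℝ) < p := by exact_mod_cast Nat.pos_of_ne_zero (NeZero.ne p)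
  conv_rhs => rw [← ZMod.coe_valMinAbs x]
  rw [ZMod.stdAddChar_coe]
  have h1 : (2 * (Real.pi : ℂ) * Complex.I * (x.valMinAbs : ℂ) / (p : ℂ)) =
      ((2 * Real.pi * x.valMinAbs / p : ℝ) : ℂ) * Complex.I := by
    push_cast
    ring
  rw [h1, Complex.exp_ofReal_mul_I_re, ← Real.cos_abs, ← Real.cos_pi_div_three]
  have h2 : (6 : ℝ) * |(x.valMinAbs : ℝ)| ≤ p := by exact_mod_cast hx
  apply Real.cos_le_cos_of_nonneg_of_le_pi (abs_nonneg _) (by linarith [Real.pi_pos])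
  rw [abs_div, abs_mul, abs_of_pos hp, abs_of_pos (by positivity), div_le_iff₀ hp]
  nlinarith [Real.pi_pos]

/-- The squared modulus of the exponential sum over `Y` at the frequency `s`. -/
noncomputable def expSumSq {p : ℕ} [NeZero p] (Y : Finset (ZMod p)) (s : ZMod p) : ℝ :=
  Complex.normSq (∑ t ∈ Y, ZMod.stdAddChar (s * t))

lemma expSumSq_nonneg {p : ℕ} [NeZero p] (Y : Finset (ZMod p)) (s : ZMod p) :
    0 ≤ expSumSq Y s := Complex.normSq_nonneg _

lemma card_sq_le_expSumSq {p : ℕ} [NeZero p] (Y : Finset (ZMod p)) (s : ZMod p)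
    (h : ∀ t ∈ Y, 6 * absRes (s * t) ≤ p) : (Y.card : ℝ) ^ 2 ≤ 4 * expSumSq Y s := by
  have h1 : (Y.card : ℝ) / 2 ≤ (∑ t ∈ Y, ZMod.stdAddChar (s * t) : ℂ).re := by
    rw [Complex.re_sum]
    calc (Y.card : ℝ) / 2 = ∑ _t ∈ Y, (1 / 2 : ℝ) := by
          rw [Finset.sum_const, nsmul_eq_mul]
          ring
      _ ≤ _ := Finset.sum_le_sum fun t ht => half_le_re_stdAddChar _ (h t ht)
  have h0 : (0 : ℝ) ≤ Y.card := by positivity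
  rw [expSumSq, Complex.normSq_apply]
  nlinarith [mul_self_nonneg (∑ t ∈ Y, ZMod.stdAddChar (s * t) : ℂ).im]

lemma expSumSq_eq {p : ℕ} [NeZero p] (Y : Finset (ZMod p)) (s : ZMod p) :
    (expSumSq Y s : ℂ) = ∑ q ∈ Y ×ˢ Y, ZMod.stdAddChar (s * (q.1 - q.2)) := by
  rw [expSumSq, ← Complex.mul_conj, map_sum, Finset.sum_mul_sum, ← Finset.sum_product']
  apply Finset.sum_congr rfl
  intro q _
  rw [← AddChar.map_neg_eq_conj, ← AddChar.map_add_eq_mul]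
  congr 1
  ring

lemma sum_expSumSq {p : ℕ} [NeZero p] (Y : Finset (ZMod p)) :
    ∑ s, expSumSq Y s = p * Y.card := by
  have h : ((∑ s, expSumSq Y s : ℝ) : ℂ) = ((p * Y.card : ℝ) : ℂ) := by
    push_cast
    simp_rw [expSumSq_eq]
    rw [Finset.sum_comm]
    simp_rw [AddChar.sum_mulShift _ (ZMod.isPrimitive_stdAddChar p), ZMod.card, sub_eq_zero]
    rw [Finset.sum_product]
    simp [mul_comm]
  exact_mod_cast h

lemma sum_expSumSq_mul {p : ℕ} [NeZero p] (Y : Finset (ZMod p)) (l : ZMod p) :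
    ∑ s, expSumSq Y s * expSumSq Y (l * s) =
      p * (((Y ×ˢ Y) ×ˢ (Y ×ˢ Y)).filter
        (fun q => (q.1.1 - q.1.2) + l * (q.2.1 - q.2.2) = 0)).card := by
  have h : ((∑ s, expSumSq Y s * expSumSq Y (l * s) : ℝ) : ℂ) =
      ((p * (((Y ×ˢ Y) ×ˢ (Y ×ˢ Y)).filter
        (fun q => (q.1.1 - q.1.2) + l * (q.2.1 - q.2.2) = 0)).card : ℝ) : ℂ) := by
    push_cast
    have h1 : ∀ s : ZMod p, (expSumSq Y s : ℂ) * expSumSq Y (l * s) =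
        ∑ q ∈ (Y ×ˢ Y) ×ˢ (Y ×ˢ Y),
          ZMod.stdAddChar (s * ((q.1.1 - q.1.2) + l * (q.2.1 - q.2.2))) := by
      intro s
      rw [expSumSq_eq, expSumSq_eq, Finset.sum_mul_sum, ← Finset.sum_product']
      apply Finset.sum_congr rfl
      intro q _
      rw [← AddChar.map_add_eq_mul]
      congr 1
      ring
    simp_rw [h1]
    rw [Finset.sum_comm]
    simp_rw [AddChar.sum_mulShift _ (ZMod.isPrimitive_stdAddChar p), ZMod.card]
    rw [Finset.card_filter]
    push_cast
    rw [Finset.mul_sum]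
    apply Finset.sum_congr rfl
    intro q _
    split_ifs <;> simp
  exact_mod_cast h

/-- If all products `xy` with `x ∈ X`, `y ∈ Y` are small residues then `|X||Y| ≤ 4p`. -/
lemma card_mul_card_le_of_absRes_le {p : ℕ} [NeZero p] (X Y : Finset (ZMod p))
    (h : ∀ x ∈ X, ∀ y ∈ Y, 6 * absRes (x * y) ≤ p) : X.card * Y.card ≤ 4 * p := by
  rcases Nat.eq_zero_or_pos Y.card with h0 | h0
  · simp [h0]
  have h1 : (X.card : ℝ) * (Y.card : ℝ) ^ 2 ≤ 4 * (p * Y.card) := by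
    rw [← sum_expSumSq, Finset.mul_sum]
    calc (X.card : ℝ) * (Y.card : ℝ) ^ 2 = ∑ _x ∈ X, (Y.card : ℝ) ^ 2 := by
          rw [Finset.sum_const, nsmul_eq_mul]
      _ ≤ ∑ x ∈ X, 4 * expSumSq Y x :=
          Finset.sum_le_sum fun x hx => card_sq_le_expSumSq Y x (h x hx)
      _ ≤ ∑ x, 4 * expSumSq Y x :=
          Finset.sum_le_sum_of_subset_of_nonneg (Finset.subset_univ _)
            fun x _ _ => mul_nonneg (by norm_num) (expSumSq_nonneg Y x)
  have h2 : X.card * Y.card ^ 2 ≤ 4 * (p * Y.card) := by exact_mod_cast h1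
  nlinarith

/-- Duality between the multiplicative ratios `l` represented by `X` and those represented
by the difference set of a set `Y` which is dual to `X`. -/
lemma card_ratio_mul_card_sq_le {p : ℕ} [NeZero p] (X Y Z : Finset (ZMod p)) (l : ZMod p)
    (h : ∀ x ∈ X, ∀ y ∈ Y, 6 * absRes (x * y) ≤ p)
    (hZ : ∀ y ∈ Y, ∀ y' ∈ Y, y - y' ∈ Z) :
    (X.filter (fun x => l * x ∈ X)).card * Y.card ^ 2 ≤
      16 * p * (Z.filter (fun z => l * z ∈ Z)).card := by
  set R := X.filter (fun x => l * x ∈ X) with hR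
  set T := Z.filter (fun z => l * z ∈ Z) with hT
  set Q := ((Y ×ˢ Y) ×ˢ (Y ×ˢ Y)).filter
        (fun q => (q.1.1 - q.1.2) + l * (q.2.1 - q.2.2) = 0) with hQ
  have h1 : (R.card : ℝ) * ((Y.card : ℝ) ^ 2) ^ 2 ≤ 16 * (p * Q.card) := by
    rw [← sum_expSumSq_mul, Finset.mul_sum]
    calc (R.card : ℝ) * ((Y.card : ℝ) ^ 2) ^ 2 = ∑ _x ∈ R, ((Y.card : ℝ) ^ 2) ^ 2 := by
          rw [Finset.sum_const, nsmul_eq_mul]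
      _ ≤ ∑ x ∈ R, 16 * (expSumSq Y x * expSumSq Y (l * x)) := by
          apply Finset.sum_le_sum
          intro x hx
          rw [hR, Finset.mem_filter] at hx
          have e1 := card_sq_le_expSumSq Y x (h x hx.1)
          have e2 := card_sq_le_expSumSq Y (l * x) (h _ hx.2)
          have := mul_le_mul e1 e2 (by positivity)
            (mul_nonneg (by norm_num) (expSumSq_nonneg Y x))
          linarith
      _ ≤ ∑ x, 16 * (expSumSq Y x * expSumSq Y (l * x)) :=
          Finset.sum_le_sum_of_subset_of_nonneg (Finset.subset_univ _)
            fun x _ _ => mul_nonneg (by norm_num)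
              (mul_nonneg (expSumSq_nonneg Y x) (expSumSq_nonneg Y _))
  have h2 : R.card * (Y.card ^ 2) ^ 2 ≤ 16 * (p * Q.card) := by exact_mod_cast h1
  have h3 : Q.card ≤ Y.card ^ 2 * T.card := by
    have : Y.card ^ 2 * T.card = ((Y ×ˢ Y) ×ˢ T).card := by
      rw [Finset.card_product, Finset.card_product, sq]
    rw [this]
    apply Finset.card_le_card_of_injOn (fun q => ((q.1.1, q.2.1), q.2.2 - q.2.1))
    · intro q hq
      rw [hQ, Finset.mem_coe, Finset.mem_filter] at hq
      simp only [Finset.mem_product] at hq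
      obtain ⟨⟨⟨q1, q2⟩, q3, q4⟩, hq⟩ := hq
      simp only [Finset.mem_coe, Finset.mem_product, hT, Finset.mem_filter]
      refine ⟨⟨q1, q3⟩, hZ _ q4 _ q3, ?_⟩
      have : l * (q.2.2 - q.2.1) = q.1.1 - q.1.2 := by linear_combination -hq
      rw [this]
      exact hZ _ q1 _ q2
    · rintro ⟨⟨a, b⟩, c, d⟩ hq ⟨⟨a', b'⟩, c', d'⟩ hq' he
      rw [hQ, Finset.mem_coe, Finset.mem_filter] at hq hq'
      simp only [Prod.mk.injEq] at he
      obtain ⟨⟨rfl, rfl⟩, he⟩ := he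
      have e1 := hq.2
      have e2 := hq'.2
      simp only at e1 e2
      have hd : d = d' := by linear_combination he
      subst hd
      have hb : b = b' := by linear_combination e2 - e1
      rw [hb]
  rcases Nat.eq_zero_or_pos Y.card with h0 | h0
  · simp [h0]
  have h4 : 0 < Y.card ^ 2 := by positivity
  have h5 : Y.card ^ 2 * (R.card * Y.card ^ 2) ≤ Y.card ^ 2 * (16 * p * T.card) := by
    have := Nat.mul_le_mul_left (16 * p) h3
    nlinarith
  exact Nat.le_of_mul_le_mul_left h5 h4

/-! ### Bohr sets of rank two -/

/-- The residues `t` for which `t a₁` and `t a₂` are at most `p / (q H₁)` and `p / (q H₂)`. -/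
def bohr {p : ℕ} [NeZero p] (a₁ a₂ : ZMod p) (H₁ H₂ q : ℕ) : Finset (ZMod p) :=
  Finset.univ.filter (fun t => (q : ℤ) * (H₁ * absRes (t * a₁)) ≤ p ∧
    (q : ℤ) * (H₂ * absRes (t * a₂)) ≤ p)

lemma mem_bohr {p : ℕ} [NeZero p] {a₁ a₂ : ZMod p} {H₁ H₂ q : ℕ} {t : ZMod p} :
    t ∈ bohr a₁ a₂ H₁ H₂ q ↔ (q : ℤ) * (H₁ * absRes (t * a₁)) ≤ p ∧
      (q : ℤ) * (H₂ * absRes (t * a₂)) ≤ p := by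
  simp [bohr]

lemma mul_mul_absRes_sub_le {p : ℕ} [NeZero p] {a t t' : ZMod p} {H q : ℕ}
    (ht : ((2 * q : ℕ) : ℤ) * (H * absRes (t * a)) ≤ p)
    (ht' : ((2 * q : ℕ) : ℤ) * (H * absRes (t' * a)) ≤ p) :
    (q : ℤ) * (H * absRes ((t - t') * a)) ≤ p := by
  have h1 := absRes_sub_le (t * a) (t' * a)
  rw [← sub_mul] at h1
  have h2 := mul_le_mul_of_nonneg_left h1 (by positivity : (0 : ℤ) ≤ q * H)
  push_cast at ht ht'
  linarith

lemma sub_mem_bohr {p : ℕ} [NeZero p] {a₁ a₂ : ZMod p} {H₁ H₂ q : ℕ} {t t' : ZMod p}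
    (ht : t ∈ bohr a₁ a₂ H₁ H₂ (2 * q)) (ht' : t' ∈ bohr a₁ a₂ H₁ H₂ (2 * q)) :
    t - t' ∈ bohr a₁ a₂ H₁ H₂ q := by
  rw [mem_bohr] at *
  exact ⟨mul_mul_absRes_sub_le ht.1 ht'.1, mul_mul_absRes_sub_le ht.2 ht'.2⟩

lemma mul_mul_absRes_sub_le_of_div_eq {p : ℕ} [NeZero p] {a t t' : ZMod p} {H q : ℕ}
    (h : q * H * (t * a).val / p = q * H * (t' * a).val / p) :
    (q : ℤ) * (H * absRes ((t - t') * a)) ≤ p := by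
  have hp : (0 : ℤ) < p := by exact_mod_cast Nat.pos_of_ne_zero (NeZero.ne p)
  have h1 := abs_sub_lt_of_ediv_eq (a := (q * H * (t * a).val : ℕ))
    (b := (q * H * (t' * a).val : ℕ)) hp (by exact_mod_cast h)
  have h2 := absRes_intCast_le (p := p) (((t * a).val : ℤ) - (t' * a).val)
  push_cast [ZMod.natCast_val, ZMod.cast_id] at h1 h2
  rw [← sub_mul] at h2
  rw [← mul_sub, abs_mul, abs_of_nonneg (by positivity)] at h1
  have h3 := mul_le_mul_of_nonneg_left h2 (by positivity : (0 : ℤ) ≤ q * H)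
  linarith

lemma le_card_bohr_mul {p : ℕ} [NeZero p] (a₁ a₂ : ZMod p) (H₁ H₂ q : ℕ)
    (hq : 0 < q) (h₁ : 0 < H₁) (h₂ : 0 < H₂) :
    p ≤ (bohr a₁ a₂ H₁ H₂ q).card * (q * H₁ * (q * H₂)) := by
  have hp : 0 < p := Nat.pos_of_ne_zero (NeZero.ne p)
  have hc : ∀ (H : ℕ) (x : ZMod p), 0 < H → q * H * x.val / p < q * H := by
    intro H x hH
    rw [Nat.div_lt_iff_lt_mul hp]
    exact Nat.mul_lt_mul_of_pos_left (ZMod.val_lt x) (by positivity)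
  have h := Finset.card_le_mul_card_image_of_maps_to (s := (Finset.univ : Finset (ZMod p)))
    (t := Finset.range (q * H₁) ×ˢ Finset.range (q * H₂))
    (f := fun t => (q * H₁ * (t * a₁).val / p, q * H₂ * (t * a₂).val / p))
    (fun t _ => by
      simp only [Finset.mem_product, Finset.mem_range]
      exact ⟨hc _ _ h₁, hc _ _ h₂⟩)
    (bohr a₁ a₂ H₁ H₂ q).card ?_
  · rwa [Finset.card_univ, ZMod.card, Finset.card_product, Finset.card_range,
      Finset.card_range] at h
  intro b _
  rcases Finset.eq_empty_or_nonempty (Finset.univ.filter (fun t : ZMod p =>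
    (q * H₁ * (t * a₁).val / p, q * H₂ * (t * a₂).val / p) = b)) with he | ⟨t₀, ht₀⟩
  · rw [he]
    simp
  apply Finset.card_le_card_of_injOn (fun t => t - t₀)
  · intro t ht
    rw [Finset.mem_coe, Finset.mem_filter] at ht
    rw [Finset.mem_filter] at ht₀
    have e := ht.2.trans ht₀.2.symm
    rw [Prod.mk.injEq] at e
    rw [Finset.mem_coe, mem_bohr]
    exact ⟨mul_mul_absRes_sub_le_of_div_eq e.1, mul_mul_absRes_sub_le_of_div_eq e.2⟩
  · intro t _ t' _ he
    exact sub_left_injective he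

lemma absRes_pos {p : ℕ} {x : ZMod p} (hx : x ≠ 0) : 0 < absRes x := by
  rw [absRes, abs_pos]
  simpa using hx

/-- Shrinking a Bohr set which keeps a nonzero element decreases its size at least linearly. -/
lemma card_bohr_mul_le {p : ℕ} [Fact p.Prime] (a₁ a₂ : ZMod p) (ha₁ : a₁ ≠ 0)
    (H₁ H₂ q k : ℕ) (hq : 2 ≤ q) (h₁ : 0 < H₁)
    (hne : ∃ t ∈ bohr a₁ a₂ H₁ H₂ (q * k), t ≠ 0) :
    (bohr a₁ a₂ H₁ H₂ (q * k)).card * k ≤ 3 * (bohr a₁ a₂ H₁ H₂ q).card := by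
  classical
  set ρ : ZMod p → ℤ := fun t => max (H₁ * absRes (t * a₁)) (H₂ * absRes (t * a₂)) with hρ
  have hmem : ∀ (r : ℕ) (t : ZMod p), t ∈ bohr a₁ a₂ H₁ H₂ r ↔ (r : ℤ) * ρ t ≤ p := by
    intro r t
    rw [mem_bohr, hρ]
    simp only
    rw [mul_max_of_nonneg _ _ (by positivity), max_le_iff]
  obtain ⟨t₁, ht₁, ht₁0⟩ := hne
  obtain ⟨t₀, ht₀, hmax⟩ := Finset.exists_max_image _ ρ ⟨t₁, ht₁⟩
  have hρpos : 0 < ρ t₀ := by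
    refine lt_of_lt_of_le ?_ (hmax t₁ ht₁)
    refine lt_of_lt_of_le ?_ (le_max_left _ _)
    have := absRes_pos (mul_ne_zero ht₁0 ha₁)
    positivity
  have hadd : ∀ t t', ρ (t + t') ≤ ρ t + ρ t' := by
    intro t t'
    have e1 := absRes_add_le (t * a₁) (t' * a₁)
    have e2 := absRes_add_le (t * a₂) (t' * a₂)
    rw [← add_mul] at e1 e2
    apply max_le
    · have := mul_le_mul_of_nonneg_left e1 (by positivity : (0 : ℤ) ≤ H₁)
      have f1 : _ ≤ ρ t := le_max_left _ _
      have f2 : _ ≤ ρ t' := le_max_left _ _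
      linarith
    · have := mul_le_mul_of_nonneg_left e2 (by positivity : (0 : ℤ) ≤ H₂)
      have f1 : _ ≤ ρ t := le_max_right _ _
      have f2 : _ ≤ ρ t' := le_max_right _ _
      linarith
  have hneg : ∀ t, ρ (-t) = ρ t := by
    intro t
    simp only [hρ, neg_mul, absRes_neg]
  have hmul_le : ∀ (t : ZMod p) (z : ℤ), ρ ((z : ZMod p) * t) ≤ |z| * ρ t := by
    intro t z
    apply max_le
    · have e := absRes_mul_intCast_le (t * a₁) z
      rw [show t * a₁ * (z : ZMod p) = z * t * a₁ by ring] at e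
      have := mul_le_mul_of_nonneg_left e (by positivity : (0 : ℤ) ≤ H₁)
      have f1 : _ ≤ ρ t := le_max_left _ _
      have := mul_le_mul_of_nonneg_left f1 (abs_nonneg z)
      linarith
    · have e := absRes_mul_intCast_le (t * a₂) z
      rw [show t * a₂ * (z : ZMod p) = z * t * a₂ by ring] at e
      have := mul_le_mul_of_nonneg_left e (by positivity : (0 : ℤ) ≤ H₂)
      have f1 : _ ≤ ρ t := le_max_right _ _
      have := mul_le_mul_of_nonneg_left f1 (abs_nonneg z)
      linarith
  have hle_mul : ∀ (t : ZMod p) (z : ℤ), 2 * (|z| * ρ t) < p → |z| * ρ t ≤ ρ ((z : ZMod p) * t) := by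
    intro t z hz
    have key : ∀ (H : ℕ) (a : ZMod p), H * absRes (t * a) ≤ ρ t →
        H * absRes ((z : ZMod p) * t * a) ≤ ρ ((z : ZMod p) * t) → ρ t = H * absRes (t * a) →
        |z| * ρ t ≤ ρ ((z : ZMod p) * t) := by
      intro H a _ f2 f3
      rcases Nat.eq_zero_or_pos H with h0 | h0
      · subst h0
        rw [f3]
        simpa using f2
      have hH : (1 : ℤ) ≤ H := by exact_mod_cast h0
      have g1 := absRes_nonneg (t * a)
      have e := absRes_mul_intCast_eq (t * a) z (by
        rw [f3] at hz
        have := mul_nonneg g1 (abs_nonneg z)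
        nlinarith)
      rw [show t * a * (z : ZMod p) = z * t * a by ring] at e
      rw [e] at f2
      rw [f3]
      linarith
    rcases max_choice ((H₁ : ℤ) * absRes (t * a₁)) (H₂ * absRes (t * a₂)) with h | h
    · exact key H₁ a₁ (le_max_left _ _) (le_max_left _ _) h
    · exact key H₂ a₂ (le_max_right _ _) (le_max_right _ _) h
  rw [hmem] at ht₀
  push_cast at ht₀
  have hM : (bohr a₁ a₂ H₁ H₂ (q * k)).card * ((k + 2) / 3) ≤ (bohr a₁ a₂ H₁ H₂ q).card := by
    conv_lhs => rw [← Finset.card_range ((k + 2) / 3), ← Finset.card_product]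
    apply Finset.card_le_card_of_injOn (fun x => x.1 + ((3 * x.2 : ℤ) : ZMod p) * t₀)
    · rintro ⟨t, m⟩ hx
      simp only [Finset.coe_product, Set.mem_prod, Finset.mem_coe, Finset.mem_range] at hx
      rw [Finset.mem_coe, hmem]
      have e1 := hadd t (((3 * m : ℤ) : ZMod p) * t₀)
      have e2 := hmul_le t₀ (3 * m)
      have e3 := hmax t hx.1
      rw [abs_of_nonneg (by positivity)] at e2
      have e4 : (3 * m + 1 : ℤ) ≤ k := by omega
      have e5 := mul_le_mul_of_nonneg_right e4 hρpos.le
      have e6 : ρ (t + ((3 * m : ℤ) : ZMod p) * t₀) ≤ k * ρ t₀ := by linarith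
      have e7 := mul_le_mul_of_nonneg_left e6 (by positivity : (0 : ℤ) ≤ q)
      linarith
    · rintro ⟨t, m⟩ hx ⟨t', m'⟩ hx' he
      simp only [Finset.coe_product, Set.mem_prod, Finset.mem_coe, Finset.mem_range] at hx hx' he
      by_cases hmm : m = m'
      · subst hmm
        rw [add_left_inj] at he
        rw [he]
      exfalso
      have e1 : ((3 * (m - m') : ℤ) : ZMod p) * t₀ = t' + -t := by
        push_cast at he ⊢
        linear_combination he
      have e2 : (3 * |((m : ℤ) - m')|) ≤ k := by
        rcases abs_cases ((m : ℤ) - m') with h | h <;> omega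
      have e3 : 1 ≤ |((m : ℤ) - m')| := Int.one_le_abs (by omega)
      have e4 := hle_mul t₀ (3 * (m - m')) (by
        rw [abs_mul, abs_of_pos (by norm_num : (0 : ℤ) < 3)]
        have hlt : 3 * |((m : ℤ) - m')| < k := by
          rcases abs_cases ((m : ℤ) - m') with h | h <;> omega
        have f1 := mul_lt_mul_of_pos_right hlt hρpos
        have f2 : (2 : ℤ) ≤ q := by exact_mod_cast hq
        have f3 : (0 : ℤ) ≤ k * ρ t₀ := by positivity
        nlinarith)
      rw [e1, abs_mul, abs_of_pos (by norm_num : (0 : ℤ) < 3)] at e4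
      have e5 := hadd t' (-t)
      rw [hneg] at e5
      have e6 := hmax t hx.1
      have e7 := hmax t' hx'.1
      nlinarith
  have hk : k ≤ 3 * ((k + 2) / 3) := by omega
  calc (bohr a₁ a₂ H₁ H₂ (q * k)).card * k
      ≤ (bohr a₁ a₂ H₁ H₂ (q * k)).card * (3 * ((k + 2) / 3)) := Nat.mul_le_mul_left _ hk
    _ = 3 * ((bohr a₁ a₂ H₁ H₂ (q * k)).card * ((k + 2) / 3)) := by ring
    _ ≤ _ := Nat.mul_le_mul_left _ hM

/-! ### Lattice points in planes and on lines -/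

lemma exists_fin_four_eq (k l : Fin 4) (hkl : k ≠ l) : ∃ i j : Fin 4,
    i ≠ j ∧ i ≠ k ∧ i ≠ l ∧ j ≠ k ∧ j ≠ l ∧ (Finset.univ : Finset (Fin 4)) = {i, j, k, l} := by
  revert k l
  decide

/-- Among more than `l²` points of a box lying in a plane, two are close to each other. -/
lemma exists_ne_abs_sub_le_of_plane (h : Fin 4 → ℕ) (hh : ∀ i, 0 < h i)
    (n n' : Fin 4 → ℤ) (hn : ∃ i j, n i * n' j ≠ n j * n' i)
    (S : Finset (Fin 4 → ℤ)) (hS : ∀ v ∈ S, ∀ i, |v i| ≤ h i)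
    (hSn : ∀ v ∈ S, ∑ i, n i * v i = 0) (hSn' : ∀ v ∈ S, ∑ i, n' i * v i = 0)
    (l : ℕ) (hl : 0 < l) (hc : l ^ 2 < S.card) :
    ∃ v ∈ S, ∃ v' ∈ S, v ≠ v' ∧ ∀ i, |v i - v' i| * l ≤ 4 * h i := by
  set q : Fin 4 → Fin 4 → ℤ := fun i j => n i * n' j - n j * n' i with hq
  obtain ⟨⟨a, b⟩, -, hmax⟩ := Finset.exists_max_image
    (Finset.univ : Finset (Fin 4 × Fin 4)) (fun x => (h x.1 : ℤ) * h x.2 * |q x.1 x.2|)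
    Finset.univ_nonempty
  simp only at hmax
  have hhZ : ∀ i, (0 : ℤ) < h i := fun i => by exact_mod_cast hh i
  have hQpos : 0 < (h a : ℤ) * h b * |q a b| := by
    obtain ⟨i, j, hij⟩ := hn
    have h1 : 0 < |q i j| := abs_pos.mpr (sub_ne_zero.mpr hij)
    exact lt_of_lt_of_le (mul_pos (mul_pos (hhZ i) (hhZ j)) h1) (hmax (i, j) (Finset.mem_univ _))
  have hab : a ≠ b := by
    rintro rfl
    simp [hq] at hQpos
  obtain ⟨i, j, hij, hia, hib, hja, hjb, hu⟩ := exists_fin_four_eq a b hab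
  have hsum : ∀ g : Fin 4 → ℤ, ∑ x, g x = g i + g j + g a + g b := by
    intro g
    rw [hu, Finset.sum_insert (by simp [hij, hia, hib]), Finset.sum_insert (by simp [hja, hjb]),
      Finset.sum_insert (by simp [hab]), Finset.sum_singleton]
    ring
  obtain ⟨v, hv, v', hv', hne, hdi, hdj⟩ := exists_ne_abs_sub_mul_le₂ S (fun v => v i)
    (fun v => v j) (h i) (h j) l hl (fun v hv => hS v hv i) (fun v hv => hS v hv j) hc
  have hd : ∑ x, n x * (v x - v' x) = 0 := by
    simp_rw [mul_sub, Finset.sum_sub_distrib]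
    rw [hSn v hv, hSn v' hv', sub_zero]
  have hd' : ∑ x, n' x * (v x - v' x) = 0 := by
    simp_rw [mul_sub, Finset.sum_sub_distrib]
    rw [hSn' v hv, hSn' v' hv', sub_zero]
  rw [hsum] at hd hd'
  set d : Fin 4 → ℤ := fun x => v x - v' x with hddef
  have hrel : ∀ c, q c b * d b + q c a * d a + q c i * d i + q c j * d j = 0 := by
    intro c
    simp only [hq, hddef]
    linear_combination n c * hd' - n' c * hd
  have key : ∀ c e : Fin 4, (∀ x, (h c : ℤ) * h x * |q c x| ≤ h c * h e * |q c e|) →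
      0 < (h c : ℤ) * h e * |q c e| → q c e * d e + q c i * d i + q c j * d j = 0 →
      |d e| * l ≤ 4 * h e := by
    intro c e hm hpos hr
    have f1 : |q c e| * |d e| ≤ |q c i| * |d i| + |q c j| * |d j| := by
      rw [← abs_mul, ← abs_mul, ← abs_mul]
      have : q c e * d e = -(q c i * d i + q c j * d j) := by linarith
      rw [this, abs_neg]
      exact abs_add_le _ _
    have f2 : ∀ x, |d x| * l ≤ 2 * h x →
        (h c : ℤ) * (|q c x| * |d x|) * l ≤ 2 * (h c * h e * |q c e|) := by
      intro x hx
      have g1 := mul_le_mul_of_nonneg_left hx (mul_nonneg (hhZ c).le (abs_nonneg (q c x)))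
      have g2 := hm x
      linarith
    have f3 := f2 i hdi
    have f4 := f2 j hdj
    have f5 := mul_le_mul_of_nonneg_left f1 (mul_nonneg (hhZ c).le (by positivity : (0 : ℤ) ≤ l))
    have f6 : h c * |q c e| * (|d e| * l) ≤ h c * |q c e| * (4 * h e) := by linarith
    refine le_of_mul_le_mul_left f6 ?_
    have := (hhZ e)
    by_contra hcon
    push Not at hcon
    nlinarith
  have hqs : ∀ x y, |q x y| = |q y x| := by
    intro x y
    rw [← abs_neg]
    simp only [hq]
    congr 1
    ring
  refine ⟨v, hv, v', hv', hne, fun x => ?_⟩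
  have hx : x ∈ ({i, j, a, b} : Finset (Fin 4)) := hu ▸ Finset.mem_univ x
  simp only [Finset.mem_insert, Finset.mem_singleton] at hx
  rcases hx with rfl | rfl | rfl | rfl
  · have := (hhZ x)
    linarith
  · have := (hhZ x)
    linarith
  · refine key b x (fun y => ?_) ?_ ?_
    · have := hmax (b, y) (Finset.mem_univ _)
      simp only at this
      rw [hqs b x]
      linarith
    · rw [hqs b x]
      linarith
    · have := hrel b
      simp only [hq] at this ⊢
      linarith
  · refine key a x (fun y => hmax (a, y) (Finset.mem_univ _)) hQpos ?_
    have := hrel a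
    simp only [hq] at this ⊢
    linarith

/-- The case of a plane which meets the second coordinate plane of `ℤ² × ℤ²` in a line. -/
lemma exists_ne_abs_sub_le_of_kernel (H₁ H₂ : ℕ)
    (n n' : Fin 4 → ℤ) (hn : ∃ i j, n i * n' j ≠ n j * n' i) (hn1 : n 1 ≠ 0) (hn3 : n 3 ≠ 0)
    (S : Finset (Fin 4 → ℤ)) (hS : ∀ v ∈ S, |v 0| ≤ H₁ ∧ |v 1| ≤ H₂ ∧ |v 2| ≤ H₁ ∧ |v 3| ≤ H₂)
    (hSn : ∀ v ∈ S, ∑ i, n i * v i = 0) (hSn' : ∀ v ∈ S, ∑ i, n' i * v i = 0)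
    (hker : ∃ v ∈ S, ∃ v' ∈ S, v ≠ v' ∧ v 0 = v' 0 ∧ v 2 = v' 2)
    (k : ℕ) (hc : k < S.card) :
    ∃ v ∈ S, ∃ v' ∈ S, v ≠ v' ∧ v 0 = v' 0 ∧ v 2 = v' 2 ∧
      |v 1 - v' 1| * k ≤ 4 * (2 * H₁ + 1) * H₂ ∧ |v 3 - v' 3| * k ≤ 4 * (2 * H₁ + 1) * H₂ := by
  simp only [Fin.sum_univ_four] at hSn hSn'
  obtain ⟨u, hu, u', hu', hne, h0, h2⟩ := hker
  rcases lt_or_ge k (2 * H₁ + 1) with hk | hk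
  · refine ⟨u, hu, u', hu', hne, h0, h2, ?_⟩
    have hkZ : (k : ℤ) ≤ 2 * H₁ + 1 := by exact_mod_cast hk.le
    have key : ∀ x y : ℤ, |x| ≤ H₂ → |y| ≤ H₂ → |x - y| * k ≤ 4 * (2 * H₁ + 1) * H₂ := by
      intro x y hx hy
      have h1 : |x - y| ≤ 2 * H₂ := (abs_sub _ _).trans (by linarith)
      have h2 := mul_le_mul h1 hkZ (by positivity) (by positivity)
      have h3 : (0 : ℤ) ≤ H₂ * (2 * H₁ + 1) := by positivity
      linarith
    exact ⟨key _ _ (hS u hu).2.1 (hS u' hu').2.1, key _ _ (hS u hu).2.2.2 (hS u' hu').2.2.2⟩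
  have hm : n 1 * n' 3 = n 3 * n' 1 := by
    have e1 : n 1 * (u 1 - u' 1) + n 3 * (u 3 - u' 3) = 0 := by
      linear_combination hSn u hu - hSn u' hu' - n 0 * h0 - n 2 * h2
    have e2 : n' 1 * (u 1 - u' 1) + n' 3 * (u 3 - u' 3) = 0 := by
      linear_combination hSn' u hu - hSn' u' hu' - n' 0 * h0 - n' 2 * h2
    have hd : u 1 - u' 1 ≠ 0 := by
      intro hd
      have hd3 : u 3 - u' 3 = 0 := by
        rw [hd, mul_zero, zero_add] at e1
        exact (mul_eq_zero.mp e1).resolve_left hn3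
      apply hne
      funext i
      fin_cases i
      · exact h0
      · exact sub_eq_zero.mp hd
      · exact h2
      · exact sub_eq_zero.mp hd3
    apply mul_right_cancel₀ hd
    linear_combination n' 3 * e1 - n 3 * e2
  obtain ⟨c, hc02, hcinj⟩ : ∃ c : Fin 4, (c = 0 ∨ c = 2) ∧
      ∀ v ∈ S, ∀ v' ∈ S, v c = v' c → v 0 = v' 0 ∧ v 2 = v' 2 := by
    have hrel : ∀ v ∈ S, (n 0 * n' 1 - n 1 * n' 0) * v 0 + (n 2 * n' 1 - n 1 * n' 2) * v 2 = 0 := by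
      intro v hv
      linear_combination n' 1 * hSn v hv - n 1 * hSn' v hv + v 3 * hm
    by_cases hb : n 2 * n' 1 - n 1 * n' 2 = 0
    · have ha : n 0 * n' 1 - n 1 * n' 0 ≠ 0 := by
        intro ha
        obtain ⟨i, j, hij⟩ := hn
        have hall : ∀ x, n x * n' 1 = n 1 * n' x := by
          intro x
          fin_cases x
          · exact sub_eq_zero.mp ha
          · rfl
          · exact sub_eq_zero.mp hb
          · exact hm.symm
        apply hij
        apply mul_left_cancel₀ hn1
        linear_combination n j * hall i - n i * hall j
      refine ⟨2, Or.inr rfl, fun v hv v' hv' he => ⟨?_, he⟩⟩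
      apply mul_left_cancel₀ ha
      linear_combination hrel v hv - hrel v' hv' - (n 2 * n' 1 - n 1 * n' 2) * he
    · refine ⟨0, Or.inl rfl, fun v hv v' hv' he => ⟨he, ?_⟩⟩
      apply mul_left_cancel₀ hb
      linear_combination hrel v hv - hrel v' hv' - (n 0 * n' 1 - n 1 * n' 0) * he
  set l := k / (2 * H₁ + 1) with hl
  have hlpos : 0 < l := Nat.div_pos hk (by omega)
  obtain ⟨y, -, hy⟩ := Finset.exists_lt_card_fiber_of_mul_lt_card_of_maps_to (s := S)
    (t := Finset.Icc (-(H₁ : ℤ)) H₁) (f := fun v => v c) (n := l) (by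
      intro v hv
      rw [Finset.mem_Icc, ← abs_le]
      rcases hc02 with rfl | rfl
      · exact (hS v hv).1
      · exact (hS v hv).2.2.1) (by
      refine lt_of_le_of_lt ?_ hc
      rw [Int.card_Icc, show ((H₁ : ℤ) + 1 - -H₁).toNat = 2 * H₁ + 1 by omega]
      exact Nat.mul_div_le k _)
  have hkl : (k : ℤ) ≤ 2 * l * (2 * H₁ + 1) := by
    have h1 := Nat.lt_mul_div_succ k (by omega : 0 < 2 * H₁ + 1)
    rw [← hl] at h1
    have h2 : k ≤ 2 * l * (2 * H₁ + 1) := by nlinarith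
    exact_mod_cast h2
  have hfin : ∀ x : ℤ, |x| * l ≤ 2 * H₂ → |x| * k ≤ 4 * (2 * H₁ + 1) * H₂ := by
    intro x hx
    have h1 := mul_le_mul_of_nonneg_left hkl (abs_nonneg x)
    have h2 := mul_le_mul_of_nonneg_right hx (by positivity : (0 : ℤ) ≤ 2 * (2 * H₁ + 1))
    linarith
  have hlin : ∀ v ∈ S, ∀ v' ∈ S, v 0 = v' 0 → v 2 = v' 2 →
      |n 1| * |v 1 - v' 1| = |n 3| * |v 3 - v' 3| := by
    intro v hv v' hv' e0 e2
    rw [← abs_mul, ← abs_mul, ← abs_neg]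
    congr 1
    linear_combination n 0 * e0 + n 2 * e2 - hSn v hv + hSn v' hv'
  have hdom : ∀ a b x y : ℤ, 0 < b → a ≤ b → 0 ≤ x → a * x = b * y → y ≤ x := by
    intro a b x y hb hab hx he
    refine le_of_mul_le_mul_left ?_ hb
    rw [← he]
    exact mul_le_mul_of_nonneg_right hab hx
  rcases le_total |n 1| |n 3| with hle | hle
  · obtain ⟨v, hv, v', hv', hvne, hd⟩ := exists_ne_abs_sub_mul_le _ (fun v => v 1) H₂ l hlpos
      (fun v hv => (hS v (Finset.mem_filter.mp hv).1).2.1) hy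
    rw [Finset.mem_filter] at hv hv'
    obtain ⟨e0, e2⟩ := hcinj v hv.1 v' hv'.1 (hv.2.trans hv'.2.symm)
    have h3 := hdom _ _ _ _ (abs_pos.mpr hn3) hle (abs_nonneg _) (hlin v hv.1 v' hv'.1 e0 e2)
    refine ⟨v, hv.1, v', hv'.1, hvne, e0, e2, hfin _ hd, hfin _ (le_trans ?_ hd)⟩
    exact mul_le_mul_of_nonneg_right h3 (by positivity)
  · obtain ⟨v, hv, v', hv', hvne, hd⟩ := exists_ne_abs_sub_mul_le _ (fun v => v 3) H₂ l hlpos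
      (fun v hv => (hS v (Finset.mem_filter.mp hv).1).2.2.2) hy
    rw [Finset.mem_filter] at hv hv'
    obtain ⟨e0, e2⟩ := hcinj v hv.1 v' hv'.1 (hv.2.trans hv'.2.symm)
    have h3 := hdom _ _ _ _ (abs_pos.mpr hn1) hle (abs_nonneg _)
      (hlin v hv.1 v' hv'.1 e0 e2).symm
    refine ⟨v, hv.1, v', hv'.1, hvne, e0, e2, hfin _ (le_trans ?_ hd), hfin _ hd⟩
    exact mul_le_mul_of_nonneg_right h3 (by positivity)

/-- The least absolute residues of the multiples by `t` of the entries of `α`. -/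
def resVec {p : ℕ} (α : Fin 4 → ZMod p) (t : ZMod p) (i : Fin 4) : ℤ := (t * α i).valMinAbs

lemma resVec_cast {p : ℕ} (α : Fin 4 → ZMod p) (t : ZMod p) (i : Fin 4) :
    (resVec α t i : ZMod p) = t * α i := ZMod.coe_valMinAbs _

lemma abs_resVec {p : ℕ} (α : Fin 4 → ZMod p) (t : ZMod p) (i : Fin 4) :
    |resVec α t i| = absRes (t * α i) := rfl

lemma sum_resVec_mul_eq_zero {p : ℕ} [NeZero p] (α : Fin 4 → ZMod p) (h : Fin 4 → ℕ)
    (t : ZMod p) (ht : ∀ i, (24 : ℤ) * (h i * absRes (t * α i)) ≤ p)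
    (v : Fin 4 → ℤ) (hv : ∀ i, |v i| ≤ h i) (hα : ∑ i, α i * (v i : ZMod p) = 0) :
    ∑ i, resVec α t i * v i = 0 := by
  have hp : (0 : ℤ) < p := by exact_mod_cast Nat.pos_of_ne_zero (NeZero.ne p)
  apply Int.eq_zero_of_abs_lt_dvd (m := p)
  · rw [← ZMod.intCast_zmod_eq_zero_iff_dvd]
    push_cast [resVec_cast]
    simp_rw [mul_assoc]
    rw [← Finset.mul_sum, hα, mul_zero]
  · have h1 : ∀ i, 24 * |resVec α t i * v i| ≤ p := by
      intro i
      rw [abs_mul, abs_resVec]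
      have := mul_le_mul_of_nonneg_left (hv i) (absRes_nonneg (t * α i))
      linarith [ht i]
    have h2 := Finset.abs_sum_le_sum_abs (fun i => resVec α t i * v i) Finset.univ
    simp only [Fin.sum_univ_four] at h2 ⊢
    linarith [h1 0, h1 1, h1 2, h1 3]

/-- If the residue vectors of more than `k` multipliers are collinear, then two of the
multipliers are close to each other. -/
lemma exists_ne_absRes_sub_le_of_collinear {p : ℕ} [Fact p.Prime] (α : Fin 4 → ZMod p)
    (hα : ∀ i, α i ≠ 0) (h : Fin 4 → ℕ) (T : Finset (ZMod p))
    (hT : ∀ t ∈ T, ∀ i, (24 : ℤ) * (h i * absRes (t * α i)) ≤ p)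
    (hcol : ∀ t ∈ T, ∀ t' ∈ T, ∀ i j,
      resVec α t i * resVec α t' j = resVec α t j * resVec α t' i)
    (k : ℕ) (hk : 0 < k) (hc : k < T.card) :
    ∃ t ∈ T, ∃ t' ∈ T, t ≠ t' ∧
      ∀ i, ((12 * k : ℕ) : ℤ) * (h i * absRes ((t - t') * α i)) ≤ p := by
  obtain ⟨t₁, ht₁, ht₁0⟩ := Finset.exists_mem_ne (show 1 < T.card by omega) 0
  obtain ⟨i, -, hmax⟩ := Finset.exists_max_image (Finset.univ : Finset (Fin 4))
    (fun i => (h i : ℤ) * |resVec α t₁ i|) Finset.univ_nonempty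
  obtain ⟨t, ht, t', ht', hne, hd⟩ := exists_ne_abs_sub_mul_le T
    (fun t => 24 * (h i * resVec α t i)) p k hk (fun t ht => by
      rw [abs_mul, abs_mul, abs_resVec, Nat.abs_cast]
      exact hT t ht i) hc
  refine ⟨t, ht, t', ht', hne, fun j => ?_⟩
  have hpos : 0 < |resVec α t₁ i| := by
    rw [abs_resVec]
    exact absRes_pos (mul_ne_zero ht₁0 (hα i))
  have e1 : (resVec α t j - resVec α t' j) * resVec α t₁ i =
      (resVec α t i - resVec α t' i) * resVec α t₁ j := by
    linear_combination hcol t ht t₁ ht₁ j i - hcol t' ht' t₁ ht₁ j i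
  have e2 : |resVec α t j - resVec α t' j| * |resVec α t₁ i| =
      |resVec α t i - resVec α t' i| * |resVec α t₁ j| := by
    rw [← abs_mul, ← abs_mul, e1]
  have e3 : h j * |resVec α t j - resVec α t' j| ≤ h i * |resVec α t i - resVec α t' i| := by
    refine le_of_mul_le_mul_right ?_ hpos
    have := mul_le_mul_of_nonneg_left (hmax j (Finset.mem_univ j))
      (abs_nonneg (resVec α t i - resVec α t' i))
    calc h j * |resVec α t j - resVec α t' j| * |resVec α t₁ i|
        = h j * (|resVec α t i - resVec α t' i| * |resVec α t₁ j|) := by rw [← e2]; ring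
      _ ≤ _ := by linarith
  have e4 : absRes ((t - t') * α j) ≤ |resVec α t j - resVec α t' j| := by
    have := absRes_intCast_le (p := p) (resVec α t j - resVec α t' j)
    push_cast [resVec_cast] at this
    rwa [← sub_mul] at this
  have e5 : |24 * (h i * resVec α t i) - 24 * (h i * resVec α t' i)| =
      24 * (h i * |resVec α t i - resVec α t' i|) := by
    rw [← mul_sub, ← mul_sub, abs_mul, abs_mul, Nat.abs_cast]
    norm_num
  rw [e5] at hd
  have e6 := mul_le_mul_of_nonneg_left e4 (by positivity : (0 : ℤ) ≤ h j)
  have e7 := mul_le_mul_of_nonneg_left (e6.trans e3) (by positivity : (0 : ℤ) ≤ 12 * k)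
  push_cast
  linarith

/-! ### Energy and ratios -/

/-- The number of nonzero `s ∈ A` with `l s ∈ A`. -/
def ratioCount {p : ℕ} (A : Finset (ZMod p)) (l : ZMod p) : ℕ :=
  ((A.erase 0).filter (fun s => l * s ∈ A)).card

lemma multEnergy_le {p : ℕ} [Fact p.Prime] (A : Finset (ZMod p)) :
    multEnergy A ≤ 4 * A.card ^ 2 +
      ∑ l ∈ Finset.univ.filter (fun l : ZMod p => l ≠ 0), ratioCount A l ^ 2 := by
  classical
  set Q := ((A ×ˢ A) ×ˢ (A ×ˢ A)).filter (fun q => q.1.1 * q.1.2 = q.2.1 * q.2.2) with hQ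
  set nz : (ZMod p × ZMod p) × (ZMod p × ZMod p) → Prop :=
    fun q => q.1.1 ≠ 0 ∧ q.1.2 ≠ 0 ∧ q.2.1 ≠ 0 ∧ q.2.2 ≠ 0 with hnz
  have h0 : (Q.filter (fun q => ¬ nz q)).card ≤ 4 * A.card ^ 2 := by
    have hsub : Q.filter (fun q => ¬ nz q) ⊆
        (((A ×ˢ A).image (fun u => ((0, u.1), (0, u.2)))) ∪
        ((A ×ˢ A).image (fun u => ((0, u.1), (u.2, 0))))) ∪
        (((A ×ˢ A).image (fun u => ((u.1, 0), (0, u.2)))) ∪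
        ((A ×ˢ A).image (fun u => ((u.1, 0), (u.2, 0))))) := by
      rintro ⟨⟨a, b⟩, c, d⟩ hq
      simp only [hQ, hnz, Finset.mem_filter, Finset.mem_product] at hq
      obtain ⟨⟨⟨⟨ha, hb⟩, hc, hd⟩, he⟩, hn⟩ := hq
      simp only [Finset.mem_union, Finset.mem_image, Finset.mem_product, Prod.mk.injEq,
        Prod.exists]
      have hab : a = 0 ∨ b = 0 := by
        by_contra! hab
        have hcd : c * d ≠ 0 := he ▸ mul_ne_zero hab.1 hab.2
        exact hn ⟨hab.1, hab.2, left_ne_zero_of_mul hcd, right_ne_zero_of_mul hcd⟩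
      have hcd : c = 0 ∨ d = 0 := by
        rw [← mul_eq_zero, ← he, mul_eq_zero]
        exact hab
      rcases hab with rfl | rfl <;> rcases hcd with rfl | rfl
      · exact Or.inl (Or.inl ⟨b, d, ⟨hb, hd⟩, ⟨rfl, rfl⟩, rfl, rfl⟩)
      · exact Or.inl (Or.inr ⟨b, c, ⟨hb, hc⟩, ⟨rfl, rfl⟩, rfl, rfl⟩)
      · exact Or.inr (Or.inl ⟨a, d, ⟨ha, hd⟩, ⟨rfl, rfl⟩, rfl, rfl⟩)
      · exact Or.inr (Or.inr ⟨a, c, ⟨ha, hc⟩, ⟨rfl, rfl⟩, rfl, rfl⟩)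
    have hi : ∀ f : ZMod p × ZMod p → (ZMod p × ZMod p) × (ZMod p × ZMod p),
        ((A ×ˢ A).image f).card ≤ A.card ^ 2 := by
      intro f
      refine Finset.card_image_le.trans ?_
      rw [Finset.card_product, sq]
    refine (Finset.card_le_card hsub).trans ((Finset.card_union_le _ _).trans ?_)
    refine (add_le_add (Finset.card_union_le _ _) (Finset.card_union_le _ _)).trans ?_
    have := hi (fun u => ((0, u.1), (0, u.2)))
    have := hi (fun u => ((0, u.1), (u.2, 0)))
    have := hi (fun u => ((u.1, 0), (0, u.2)))
    have := hi (fun u => ((u.1, 0), (u.2, 0)))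
    omega
  have h1 : (Q.filter nz).card ≤
      ∑ l ∈ Finset.univ.filter (fun l : ZMod p => l ≠ 0), ratioCount A l ^ 2 := by
    rw [Finset.card_eq_sum_card_fiberwise (f := fun q => q.1.1 / q.2.1)
      (t := Finset.univ.filter (fun l : ZMod p => l ≠ 0))]
    · apply Finset.sum_le_sum
      intro l hl
      rw [ratioCount, sq, ← Finset.card_product]
      apply Finset.card_le_card_of_injOn (fun q => (q.2.1, q.1.2))
      · rintro ⟨⟨a, b⟩, c, d⟩ hq
        simp only [hQ, hnz, Finset.coe_filter, Finset.mem_filter, Finset.mem_product,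
          Set.mem_ofPred_eq] at hq
        obtain ⟨⟨⟨⟨⟨ha, hb⟩, hc, hd⟩, he⟩, ha0, hb0, hc0, hd0⟩, rfl⟩ := hq
        simp only [Finset.coe_product, Set.mem_prod, Finset.mem_coe, Finset.mem_filter,
          Finset.mem_erase]
        refine ⟨⟨⟨hc0, hc⟩, ?_⟩, ⟨hb0, hb⟩, ?_⟩
        · rwa [div_mul_cancel₀ _ hc0]
        · rwa [div_mul_eq_mul_div, he, mul_div_cancel_left₀ _ hc0]
      · rintro ⟨⟨a, b⟩, c, d⟩ hq ⟨⟨a', b'⟩, c', d'⟩ hq' he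
        simp only [hQ, hnz, Finset.coe_filter, Finset.mem_filter, Finset.mem_product,
          Set.mem_ofPred_eq] at hq hq'
        simp only [Prod.mk.injEq] at he
        obtain ⟨rfl, rfl⟩ := he
        have hc0 := hq.1.2.2.2.1
        have haa : a = a' := by
          have := hq.2.trans hq'.2.symm
          rwa [div_left_inj' hc0] at this
        subst haa
        have hdd : d = d' := by
          apply mul_left_cancel₀ hc0
          rw [← hq.1.1.2, ← hq'.1.1.2]
        rw [hdd]
    · rintro q hq
      simp only [hnz, Finset.coe_filter, Set.mem_ofPred_eq, Finset.mem_univ, true_and] at hq ⊢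
      exact div_ne_zero hq.2.1 hq.2.2.2.1
  have h2 := Finset.card_filter_add_card_filter_not (s := Q) nz
  rw [multEnergy, ← hQ]
  omega

/-! ### Ratios of elements of a progression of rank two -/

/-- The coefficients of the linear form `a₁ x₁ + a₂ x₂ - l (a₁ y₁ + a₂ y₂)`. -/
def formVec {p : ℕ} (a₁ a₂ l : ZMod p) : Fin 4 → ZMod p := ![a₁, a₂, -(l * a₁), -(l * a₂)]

/-- The points `(x₁, x₂, y₁, y₂)` of the box with `a₁ x₁ + a₂ x₂ = l (a₁ y₁ + a₂ y₂)`. -/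
noncomputable def ratioLattice {p : ℕ} (a₁ a₂ : ZMod p) (H₁ H₂ : ℕ) (l : ZMod p) : Finset (Fin 4 → ℤ) :=
  (Fintype.piFinset fun i => Finset.Icc (-((![H₁, H₂, H₁, H₂] : Fin 4 → ℕ) i : ℤ))
    ((![H₁, H₂, H₁, H₂] : Fin 4 → ℕ) i)).filter
      (fun v => a₁ * (v 0 : ZMod p) + a₂ * (v 1 : ZMod p) =
        l * (a₁ * (v 2 : ZMod p) + a₂ * (v 3 : ZMod p)))

lemma mem_ratioLattice {p : ℕ} {a₁ a₂ : ZMod p} {H₁ H₂ : ℕ} {l : ZMod p} {v : Fin 4 → ℤ} :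
    v ∈ ratioLattice a₁ a₂ H₁ H₂ l ↔
      (|v 0| ≤ H₁ ∧ |v 1| ≤ H₂ ∧ |v 2| ≤ H₁ ∧ |v 3| ≤ H₂) ∧
      a₁ * (v 0 : ZMod p) + a₂ * (v 1 : ZMod p) =
        l * (a₁ * (v 2 : ZMod p) + a₂ * (v 3 : ZMod p)) := by
  simp [ratioLattice, Fin.forall_fin_succ, abs_le]

/-- The multipliers `t` in a Bohr set for which `l t` lies in the same Bohr set. -/
def dualMultipliers {p : ℕ} [NeZero p] (a₁ a₂ : ZMod p) (H₁ H₂ : ℕ) (l : ZMod p) :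
    Finset (ZMod p) :=
  (bohr a₁ a₂ H₁ H₂ 24).filter (fun t => l * t ∈ bohr a₁ a₂ H₁ H₂ 24)

lemma forall_mul_absRes_formVec_iff {p : ℕ} [NeZero p] {a₁ a₂ : ZMod p} {H₁ H₂ q : ℕ}
    {l t : ZMod p} :
    (∀ i, (q : ℤ) * ((![H₁, H₂, H₁, H₂] : Fin 4 → ℕ) i * absRes (t * formVec a₁ a₂ l i)) ≤ p) ↔
      t ∈ bohr a₁ a₂ H₁ H₂ q ∧ l * t ∈ bohr a₁ a₂ H₁ H₂ q := by
  have h1 : ∀ a : ZMod p, t * -(l * a) = -(l * t * a) := fun a => by ring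
  simp [mem_bohr, Fin.forall_fin_succ, formVec, h1, absRes_neg, and_assoc]

/-- The residue vectors of the dual multipliers of `l` span at least a plane. -/
def HasDualPlane {p : ℕ} [NeZero p] (a₁ a₂ : ZMod p) (H₁ H₂ : ℕ) (l : ZMod p) : Prop :=
  ∃ t ∈ dualMultipliers a₁ a₂ H₁ H₂ l, ∃ t' ∈ dualMultipliers a₁ a₂ H₁ H₂ l, ∃ i j,
    resVec (formVec a₁ a₂ l) t i * resVec (formVec a₁ a₂ l) t' j ≠
      resVec (formVec a₁ a₂ l) t j * resVec (formVec a₁ a₂ l) t' i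

lemma formVec_ne_zero {p : ℕ} [Fact p.Prime] {a₁ a₂ l : ZMod p} (ha₁ : a₁ ≠ 0) (ha₂ : a₂ ≠ 0)
    (hl : l ≠ 0) (i : Fin 4) : formVec a₁ a₂ l i ≠ 0 := by
  fin_cases i <;> simp [formVec, ha₁, ha₂, hl]

lemma exists_mem_bohr_of_not_hasDualPlane {p : ℕ} [Fact p.Prime] {a₁ a₂ : ZMod p}
    (ha₁ : a₁ ≠ 0) (ha₂ : a₂ ≠ 0) {H₁ H₂ : ℕ} {l : ZMod p} (hl : l ≠ 0)
    (h : ¬ HasDualPlane a₁ a₂ H₁ H₂ l) {k : ℕ} (hk : 0 < k)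
    (hc : k < (dualMultipliers a₁ a₂ H₁ H₂ l).card) :
    ∃ t ∈ bohr a₁ a₂ H₁ H₂ (12 * k), t ≠ 0 ∧ l * t ∈ bohr a₁ a₂ H₁ H₂ (12 * k) := by
  have hcol : ∀ t ∈ dualMultipliers a₁ a₂ H₁ H₂ l, ∀ t' ∈ dualMultipliers a₁ a₂ H₁ H₂ l,
      ∀ i j, resVec (formVec a₁ a₂ l) t i * resVec (formVec a₁ a₂ l) t' j =
        resVec (formVec a₁ a₂ l) t j * resVec (formVec a₁ a₂ l) t' i := by
    intro t ht t' ht' i j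
    by_contra hne
    exact h ⟨t, ht, t', ht', i, j, hne⟩
  obtain ⟨t, -, t', -, hne, hd⟩ := exists_ne_absRes_sub_le_of_collinear (formVec a₁ a₂ l)
    (formVec_ne_zero ha₁ ha₂ hl) ![H₁, H₂, H₁, H₂] _
    (fun t ht => by
      have := forall_mul_absRes_formVec_iff.mpr (Finset.mem_filter.mp ht)
      exact_mod_cast this) hcol k hk hc
  rw [forall_mul_absRes_formVec_iff] at hd
  exact ⟨t - t', hd.1, sub_ne_zero.mpr hne, hd.2⟩

/-- Level sets of the number of dual multipliers, over the ratios without a dual plane. -/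
lemma card_not_hasDualPlane_mul_le {p : ℕ} [Fact p.Prime] {a₁ a₂ : ZMod p}
    (ha₁ : a₁ ≠ 0) (ha₂ : a₂ ≠ 0) {H₁ H₂ : ℕ} (h₁ : 0 < H₁) (N : ℕ)
    (hN : N * (bohr a₁ a₂ H₁ H₂ 12).card ≤ 4 * p) {k : ℕ} (hk : 0 < k) (L : Finset (ZMod p))
    (hL : ∀ l ∈ L, l ≠ 0 ∧ ¬ HasDualPlane a₁ a₂ H₁ H₂ l ∧
      k < (dualMultipliers a₁ a₂ H₁ H₂ l).card) :
    L.card * k ^ 2 * N ^ 2 ≤ 144 * p ^ 2 := by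
  classical
  rcases L.eq_empty_or_nonempty with rfl | ⟨l₀, hl₀⟩
  · simp
  set B := bohr a₁ a₂ H₁ H₂ (12 * k) with hB
  have hex : ∀ l ∈ L, ∃ t ∈ B, t ≠ 0 ∧ l * t ∈ B := fun l hl =>
    exists_mem_bohr_of_not_hasDualPlane ha₁ ha₂ (hL l hl).1 (hL l hl).2.1 hk (hL l hl).2.2
  have hLB : L.card ≤ B.card ^ 2 := by
    rw [sq, ← Finset.card_product]
    refine (Finset.card_le_card ?_).trans
      (Finset.card_image_le (s := B ×ˢ B) (f := fun x => x.2 / x.1))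
    intro l hl
    obtain ⟨t, ht, ht0, hlt⟩ := hex l hl
    rw [Finset.mem_image]
    exact ⟨(t, l * t), Finset.mem_product.mpr ⟨ht, hlt⟩, mul_div_cancel_right₀ _ ht0⟩
  have hBk : B.card * k ≤ 3 * (bohr a₁ a₂ H₁ H₂ 12).card := by
    obtain ⟨t, ht, ht0, -⟩ := hex l₀ hl₀
    exact card_bohr_mul_le a₁ a₂ ha₁ H₁ H₂ 12 k (by norm_num) h₁ ⟨t, ht, ht0⟩
  have h3 : B.card * k * N ≤ 12 * p := by nlinarith
  calc L.card * k ^ 2 * N ^ 2 ≤ B.card ^ 2 * k ^ 2 * N ^ 2 := by gcongr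
    _ = (B.card * k * N) ^ 2 := by ring
    _ ≤ (12 * p) ^ 2 := Nat.pow_le_pow_left h3 2
    _ = 144 * p ^ 2 := by ring

lemma card_ratio_le {p : ℕ} [Fact p.Prime] (a₁ a₂ : ZMod p) (W₁ W₂ : ℕ) (L : Finset (ZMod p))
    (hL : ∀ l ∈ L, ∃ d : Fin 4 → ℤ, |d 0| ≤ W₁ ∧ |d 1| ≤ W₂ ∧ |d 2| ≤ W₁ ∧ |d 3| ≤ W₂ ∧
      a₁ * (d 2 : ZMod p) + a₂ * (d 3 : ZMod p) ≠ 0 ∧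
      a₁ * (d 0 : ZMod p) + a₂ * (d 1 : ZMod p) =
        l * (a₁ * (d 2 : ZMod p) + a₂ * (d 3 : ZMod p))) :
    L.card ≤ ((2 * W₁ + 1) * (2 * W₂ + 1)) ^ 2 := by
  classical
  set B := Finset.Icc (-(W₁ : ℤ)) W₁ ×ˢ Finset.Icc (-(W₂ : ℤ)) W₂ with hB
  have hBc : B.card = (2 * W₁ + 1) * (2 * W₂ + 1) := by
    rw [hB, Finset.card_product, Int.card_Icc, Int.card_Icc]
    congr 1 <;> omega
  rw [← hBc, sq, ← Finset.card_product]
  refine (Finset.card_le_card ?_).trans (Finset.card_image_le (s := B ×ˢ B)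
    (f := fun x => (a₁ * (x.1.1 : ZMod p) + a₂ * (x.1.2 : ZMod p)) /
      (a₁ * (x.2.1 : ZMod p) + a₂ * (x.2.2 : ZMod p))))
  intro l hl
  obtain ⟨d, h0, h1, h2, h3, hne, he⟩ := hL l hl
  rw [Finset.mem_image]
  refine ⟨((d 0, d 1), (d 2, d 3)), ?_, ?_⟩
  · simp only [hB, Finset.mem_product, Finset.mem_Icc, ← abs_le]
    exact ⟨⟨h0, h1⟩, h2, h3⟩
  · simp only
    rw [he, mul_div_cancel_right₀ _ hne]

lemma ratioLattice_sub {p : ℕ} [Fact p.Prime] {a₁ a₂ : ZMod p} {H₁ H₂ : ℕ}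
    (hinj : ∀ x₁ x₂ y₁ y₂ : ℤ, |x₁| ≤ H₁ → |x₂| ≤ H₂ → |y₁| ≤ H₁ → |y₂| ≤ H₂ →
      a₁ * (x₁ : ZMod p) + a₂ * (x₂ : ZMod p) = a₁ * (y₁ : ZMod p) + a₂ * (y₂ : ZMod p) →
      x₁ = y₁ ∧ x₂ = y₂) {l : ZMod p} {v v' : Fin 4 → ℤ}
    (hv : v ∈ ratioLattice a₁ a₂ H₁ H₂ l) (hv' : v' ∈ ratioLattice a₁ a₂ H₁ H₂ l)
    (hne : v ≠ v') :
    a₁ * ((v 2 - v' 2 : ℤ) : ZMod p) + a₂ * ((v 3 - v' 3 : ℤ) : ZMod p) ≠ 0 ∧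
      a₁ * ((v 0 - v' 0 : ℤ) : ZMod p) + a₂ * ((v 1 - v' 1 : ℤ) : ZMod p) =
        l * (a₁ * ((v 2 - v' 2 : ℤ) : ZMod p) + a₂ * ((v 3 - v' 3 : ℤ) : ZMod p)) := by
  rw [mem_ratioLattice] at hv hv'
  obtain ⟨⟨b0, b1, b2, b3⟩, e⟩ := hv
  obtain ⟨⟨b0', b1', b2', b3'⟩, e'⟩ := hv'
  push_cast
  refine ⟨fun h0 => hne ?_, by linear_combination e - e'⟩
  obtain ⟨f2, f3⟩ := hinj _ _ _ _ b2 b3 b2' b3' (by linear_combination h0)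
  obtain ⟨f0, f1⟩ := hinj _ _ _ _ b0 b1 b0' b1' (by rw [e, e', f2, f3])
  funext i
  fin_cases i <;> assumption

lemma exists_small_ratio_of_hasDualPlane {p : ℕ} [Fact p.Prime] {a₁ a₂ : ZMod p}
    (ha₁ : a₁ ≠ 0) (ha₂ : a₂ ≠ 0) {H₁ H₂ : ℕ} (h₁ : 0 < H₁) (h₂ : 0 < H₂) {l : ZMod p}
    (hl : l ≠ 0) (h : HasDualPlane a₁ a₂ H₁ H₂ l) {k : ℕ} (hk : 0 < k)
    (hc : k < (ratioLattice a₁ a₂ H₁ H₂ l).card) :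
    (k ≤ (2 * H₁ + 1) ^ 2 ∧ ∃ v ∈ ratioLattice a₁ a₂ H₁ H₂ l,
      ∃ v' ∈ ratioLattice a₁ a₂ H₁ H₂ l, v ≠ v' ∧
        ∀ i, |v i - v' i| * k.sqrt ≤ 4 * (![H₁, H₂, H₁, H₂] : Fin 4 → ℕ) i) ∨
    (∃ v ∈ ratioLattice a₁ a₂ H₁ H₂ l, ∃ v' ∈ ratioLattice a₁ a₂ H₁ H₂ l, v ≠ v' ∧
      v 0 = v' 0 ∧ v 2 = v' 2 ∧
      |v 1 - v' 1| * k ≤ 4 * (2 * H₁ + 1) * H₂ ∧ |v 3 - v' 3| * k ≤ 4 * (2 * H₁ + 1) * H₂) := by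
  classical
  obtain ⟨t, ht, t', ht', i, j, hij⟩ := h
  set S := ratioLattice a₁ a₂ H₁ H₂ l with hS
  have hbd : ∀ v ∈ S, ∀ i, |v i| ≤ (![H₁, H₂, H₁, H₂] : Fin 4 → ℕ) i := by
    intro v hv
    obtain ⟨⟨b0, b1, b2, b3⟩, -⟩ := mem_ratioLattice.mp hv
    intro i
    fin_cases i <;> simpa
  have hform : ∀ v ∈ S, ∑ i, formVec a₁ a₂ l i * (v i : ZMod p) = 0 := by
    intro v hv
    have := (mem_ratioLattice.mp hv).2
    simp only [Fin.sum_univ_four, formVec, Matrix.cons_val]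
    linear_combination this
  have horth : ∀ t ∈ dualMultipliers a₁ a₂ H₁ H₂ l, ∀ v ∈ S,
      ∑ i, resVec (formVec a₁ a₂ l) t i * v i = 0 := by
    intro t ht v hv
    refine sum_resVec_mul_eq_zero _ ![H₁, H₂, H₁, H₂] t ?_ v (hbd v hv) (hform v hv)
    have := forall_mul_absRes_formVec_iff.mpr (Finset.mem_filter.mp ht)
    exact_mod_cast this
  by_cases hker : ∃ v ∈ S, ∃ v' ∈ S, v ≠ v' ∧ v 0 = v' 0 ∧ v 2 = v' 2
  · right
    have ht0 : t ≠ 0 := by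
      rintro rfl
      simp [resVec] at hij
    have hn : ∀ x, resVec (formVec a₁ a₂ l) t x ≠ 0 := by
      intro x
      rw [← abs_pos, abs_resVec]
      exact absRes_pos (mul_ne_zero ht0 (formVec_ne_zero ha₁ ha₂ hl x))
    exact exists_ne_abs_sub_le_of_kernel H₁ H₂ _ _ ⟨i, j, hij⟩ (hn 1) (hn 3) S
      (fun v hv => (mem_ratioLattice.mp hv).1) (horth t ht) (horth t' ht') hker k hc
  · left
    constructor
    · refine hc.le.trans ?_
      have hcard : ((Finset.Icc (-(H₁ : ℤ)) H₁) ×ˢ (Finset.Icc (-(H₁ : ℤ)) H₁)).card =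
          (2 * H₁ + 1) ^ 2 := by
        rw [Finset.card_product, Int.card_Icc, sq]
        congr 1 <;> omega
      rw [← hcard]
      apply Finset.card_le_card_of_injOn (fun v => (v 0, v 2))
      · intro v hv
        obtain ⟨⟨b0, -, b2, -⟩, -⟩ := mem_ratioLattice.mp hv
        simp only [Finset.mem_coe, Finset.mem_product, Finset.mem_Icc, ← abs_le]
        exact ⟨b0, b2⟩
      · intro v hv v' hv' he
        rw [Prod.mk.injEq] at he
        by_contra hne
        exact hker ⟨v, hv, v', hv', hne, he⟩
    · refine exists_ne_abs_sub_le_of_plane ![H₁, H₂, H₁, H₂] ?_ _ _ ⟨i, j, hij⟩ S hbd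
        (horth t ht) (horth t' ht') k.sqrt (Nat.sqrt_pos.mpr hk)
        (lt_of_le_of_lt (Nat.sqrt_le' k) hc)
      intro x
      fin_cases x <;> simpa

lemma abs_le_div_of_mul_le {x : ℤ} {k N : ℕ} (hk : 0 < k) (h : |x| * k ≤ N) :
    |x| ≤ ((N / k : ℕ) : ℤ) := by
  push_cast
  rw [Int.le_ediv_iff_mul_le (by exact_mod_cast hk)]
  exact h

/-- Level sets of the number of representations, over the ratios with a dual plane. -/
lemma card_hasDualPlane_mul_le {p : ℕ} [Fact p.Prime] {a₁ a₂ : ZMod p}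
    (ha₁ : a₁ ≠ 0) (ha₂ : a₂ ≠ 0) {H₁ H₂ : ℕ} (h₁ : 0 < H₁) (h₁₂ : H₁ ≤ H₂)
    (hinj : ∀ x₁ x₂ y₁ y₂ : ℤ, |x₁| ≤ H₁ → |x₂| ≤ H₂ → |y₁| ≤ H₁ → |y₂| ≤ H₂ →
      a₁ * (x₁ : ZMod p) + a₂ * (x₂ : ZMod p) = a₁ * (y₁ : ZMod p) + a₂ * (y₂ : ZMod p) →
      x₁ = y₁ ∧ x₂ = y₂) {k : ℕ} (hk : 0 < k) (L : Finset (ZMod p))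
    (hL : ∀ l ∈ L, l ≠ 0 ∧ HasDualPlane a₁ a₂ H₁ H₂ l ∧
      k < (ratioLattice a₁ a₂ H₁ H₂ l).card) :
    L.card * k ^ 2 ≤ 250000 * (H₁ * H₂) ^ 2 := by
  classical
  set E : ZMod p → Prop := fun l => ∃ v ∈ ratioLattice a₁ a₂ H₁ H₂ l,
      ∃ v' ∈ ratioLattice a₁ a₂ H₁ H₂ l, v ≠ v' ∧
        ∀ i, |v i - v' i| * k.sqrt ≤ 4 * (![H₁, H₂, H₁, H₂] : Fin 4 → ℕ) i with hE
  have hcases := fun l hl => exists_small_ratio_of_hasDualPlane ha₁ ha₂ h₁ (h₁.trans_le h₁₂)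
    (hL l hl).1 (hL l hl).2.1 hk (hL l hl).2.2
  have hsplit := Finset.card_filter_add_card_filter_not (s := L)
    (fun l => k ≤ (2 * H₁ + 1) ^ 2 ∧ E l)
  have hs : 0 < k.sqrt := Nat.sqrt_pos.mpr hk
  have hplane : (L.filter (fun l => k ≤ (2 * H₁ + 1) ^ 2 ∧ E l)).card * k ^ 2 ≤
      (484 * (H₁ * H₂)) ^ 2 := by
    rcases (L.filter (fun l => k ≤ (2 * H₁ + 1) ^ 2 ∧ E l)).eq_empty_or_nonempty with h0 | ⟨l₀, hl₀⟩
    · rw [h0]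
      simp
    have hk1 := (Finset.mem_filter.mp hl₀).2.1
    have h1 := card_ratio_le a₁ a₂ (4 * H₁ / k.sqrt) (4 * H₂ / k.sqrt)
      (L.filter (fun l => k ≤ (2 * H₁ + 1) ^ 2 ∧ E l)) (by
        intro l hl
        obtain ⟨v, hv, v', hv', hne, hd⟩ := (Finset.mem_filter.mp hl).2.2
        have hd' := fun i => abs_le_div_of_mul_le hs
          (N := 4 * (![H₁, H₂, H₁, H₂] : Fin 4 → ℕ) i) (by exact_mod_cast hd i)
        exact ⟨fun i => v i - v' i, hd' 0, hd' 1, hd' 2, hd' 3,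
          ratioLattice_sub hinj hv hv' hne⟩)
    have hs1 : k.sqrt ≤ 2 * H₁ + 1 := by
      rw [← Nat.sqrt_eq' (2 * H₁ + 1)]
      exact Nat.sqrt_le_sqrt hk1
    have hW : ∀ H, H₁ ≤ H → (2 * (4 * H / k.sqrt) + 1) * k.sqrt ≤ 11 * H := by
      intro H hH
      have := Nat.div_mul_le_self (4 * H) k.sqrt
      nlinarith
    have hk4 : k ≤ 4 * k.sqrt ^ 2 := by
      have := Nat.lt_succ_sqrt' k
      rw [Nat.succ_eq_add_one] at this
      nlinarith
    have h2 : (2 * (4 * H₁ / k.sqrt) + 1) * (2 * (4 * H₂ / k.sqrt) + 1) * k ≤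
        484 * (H₁ * H₂) := by
      calc _ ≤ (2 * (4 * H₁ / k.sqrt) + 1) * (2 * (4 * H₂ / k.sqrt) + 1) *
            (4 * k.sqrt ^ 2) := Nat.mul_le_mul_left _ hk4
        _ = 4 * (((2 * (4 * H₁ / k.sqrt) + 1) * k.sqrt) *
            ((2 * (4 * H₂ / k.sqrt) + 1) * k.sqrt)) := by ring
        _ ≤ 4 * ((11 * H₁) * (11 * H₂)) :=
            Nat.mul_le_mul_left _ (Nat.mul_le_mul (hW _ le_rfl) (hW _ h₁₂))
        _ = _ := by ring
    calc _ ≤ ((2 * (4 * H₁ / k.sqrt) + 1) * (2 * (4 * H₂ / k.sqrt) + 1)) ^ 2 * k ^ 2 :=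
          Nat.mul_le_mul_right _ h1
      _ = ((2 * (4 * H₁ / k.sqrt) + 1) * (2 * (4 * H₂ / k.sqrt) + 1) * k) ^ 2 := by ring
      _ ≤ _ := Nat.pow_le_pow_left h2 2
  have hline : (L.filter (fun l => ¬ (k ≤ (2 * H₁ + 1) ^ 2 ∧ E l))).card * k ^ 2 ≤
      (36 * (H₁ * H₂)) ^ 2 := by
    rcases (L.filter (fun l => ¬ (k ≤ (2 * H₁ + 1) ^ 2 ∧ E l))).eq_empty_or_nonempty
      with h0 | ⟨l₀, hl₀⟩
    · rw [h0]
      simp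
    set W := 4 * (2 * H₁ + 1) * H₂ / k with hW
    have hex : ∀ l ∈ L.filter (fun l => ¬ (k ≤ (2 * H₁ + 1) ^ 2 ∧ E l)), ∃ d : Fin 4 → ℤ,
        |d 0| ≤ (0 : ℕ) ∧ |d 1| ≤ W ∧ |d 2| ≤ (0 : ℕ) ∧ |d 3| ≤ W ∧
        a₁ * (d 2 : ZMod p) + a₂ * (d 3 : ZMod p) ≠ 0 ∧
        a₁ * (d 0 : ZMod p) + a₂ * (d 1 : ZMod p) =
          l * (a₁ * (d 2 : ZMod p) + a₂ * (d 3 : ZMod p)) := by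
      intro l hl
      rw [Finset.mem_filter] at hl
      obtain ⟨v, hv, v', hv', hne, e0, e2, hd1, hd3⟩ := (hcases l hl.1).resolve_left hl.2
      refine ⟨fun i => v i - v' i, by simp [e0], ?_, by simp [e2], ?_,
        ratioLattice_sub hinj hv hv' hne⟩
      · exact abs_le_div_of_mul_le hk (by exact_mod_cast hd1)
      · exact abs_le_div_of_mul_le hk (by exact_mod_cast hd3)
    have h1 := card_ratio_le a₁ a₂ 0 W _ hex
    have hWpos : 1 ≤ W := by
      obtain ⟨d, -, -, hd2, hd3, hne, -⟩ := hex l₀ hl₀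
      by_contra hlt
      have hW0 : W = 0 := Nat.lt_one_iff.mp (not_le.mp hlt)
      rw [hW0] at hd3
      have e2 : d 2 = 0 := abs_nonpos_iff.mp (by exact_mod_cast hd2)
      have e3 : d 3 = 0 := abs_nonpos_iff.mp (by exact_mod_cast hd3)
      simp [e2, e3] at hne
    have hWk : W * k ≤ 4 * (2 * H₁ + 1) * H₂ := Nat.div_mul_le_self _ _
    have h2 : (2 * W + 1) * k ≤ 36 * (H₁ * H₂) := by
      calc (2 * W + 1) * k ≤ (3 * W) * k := Nat.mul_le_mul_right _ (by omega)
        _ = 3 * (W * k) := by ring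
        _ ≤ 3 * (4 * (2 * H₁ + 1) * H₂) := Nat.mul_le_mul_left _ hWk
        _ ≤ 3 * (4 * (3 * H₁) * H₂) := by gcongr; omega
        _ = _ := by ring
    calc _ ≤ ((2 * 0 + 1) * (2 * W + 1)) ^ 2 * k ^ 2 := Nat.mul_le_mul_right _ h1
      _ = ((2 * W + 1) * k) ^ 2 := by ring
      _ ≤ _ := Nat.pow_le_pow_left h2 2
  rw [← hsplit]
  nlinarith

lemma ratioCount_lt_card_ratioLattice {p : ℕ} [NeZero p] {a₁ a₂ : ZMod p} {H₁ H₂ : ℕ}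
    {A : Finset (ZMod p)}
    (hA : ∀ s ∈ A, ∃ x y : ℤ, |x| ≤ H₁ ∧ |y| ≤ H₂ ∧ a₁ * (x : ZMod p) + a₂ * (y : ZMod p) = s)
    (l : ZMod p) : ratioCount A l < (ratioLattice a₁ a₂ H₁ H₂ l).card := by
  classical
  choose! x y hx hy hxy using hA
  set f : ZMod p → Fin 4 → ℤ := fun s => ![x (l * s), y (l * s), x s, y s] with hf
  have h0 : (0 : Fin 4 → ℤ) ∈ ratioLattice a₁ a₂ H₁ H₂ l := by
    rw [mem_ratioLattice]
    simp
  have h1 : ratioCount A l ≤ ((ratioLattice a₁ a₂ H₁ H₂ l).erase 0).card := by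
    apply Finset.card_le_card_of_injOn f
    · intro s hs
      rw [Finset.mem_coe, Finset.mem_filter, Finset.mem_erase] at hs
      obtain ⟨⟨hs0, hs⟩, hls⟩ := hs
      rw [Finset.mem_coe, Finset.mem_erase, mem_ratioLattice]
      refine ⟨fun he => hs0 ?_, ⟨hx _ hls, hy _ hls, hx _ hs, hy _ hs⟩, ?_⟩
      · have e2 : x s = 0 := congrFun he 2
        have e3 : y s = 0 := congrFun he 3
        rw [← hxy s hs, e2, e3]
        simp
      · change a₁ * (x (l * s) : ZMod p) + a₂ * (y (l * s) : ZMod p) =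
          l * (a₁ * (x s : ZMod p) + a₂ * (y s : ZMod p))
        rw [hxy _ hls, hxy _ hs]
    · intro s hs s' hs' he
      rw [Finset.mem_coe, Finset.mem_filter, Finset.mem_erase] at hs hs'
      have e2 : x s = x s' := congrFun he 2
      have e3 : y s = y s' := congrFun he 3
      rw [← hxy s hs.1.2, ← hxy s' hs'.1.2, e2, e3]
  have h2 := Finset.card_erase_lt_of_mem h0
  omega

lemma absRes_mul_le_of_mem_bohr {p : ℕ} [NeZero p] {a₁ a₂ : ZMod p} {H₁ H₂ q : ℕ} (hq : 12 ≤ q)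
    {x y : ℤ} (hx : |x| ≤ H₁) (hy : |y| ≤ H₂) {t : ZMod p} (ht : t ∈ bohr a₁ a₂ H₁ H₂ q) :
    6 * absRes ((a₁ * (x : ZMod p) + a₂ * (y : ZMod p)) * t) ≤ p := by
  rw [mem_bohr] at ht
  have h1 := absRes_add_le (t * a₁ * (x : ZMod p)) (t * a₂ * (y : ZMod p))
  rw [show t * a₁ * (x : ZMod p) + t * a₂ * (y : ZMod p) =
    (a₁ * (x : ZMod p) + a₂ * (y : ZMod p)) * t by ring] at h1
  have h2 := absRes_mul_intCast_le (t * a₁) x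
  have h3 := absRes_mul_intCast_le (t * a₂) y
  have h4 := mul_le_mul_of_nonneg_left hx (absRes_nonneg (t * a₁))
  have h5 := mul_le_mul_of_nonneg_left hy (absRes_nonneg (t * a₂))
  have hq' : (12 : ℤ) ≤ q := by exact_mod_cast hq
  have h6 := mul_le_mul_of_nonneg_right hq'
    (mul_nonneg (by positivity : (0 : ℤ) ≤ H₁) (absRes_nonneg (t * a₁)))
  have h7 := mul_le_mul_of_nonneg_right hq'
    (mul_nonneg (by positivity : (0 : ℤ) ≤ H₂) (absRes_nonneg (t * a₂)))
  linarith [ht.1, ht.2]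

lemma ratioCount_mul_le {p : ℕ} [NeZero p] {a₁ a₂ : ZMod p} {H₁ H₂ : ℕ}
    (h₁ : 0 < H₁) (h₂ : 0 < H₂) {A : Finset (ZMod p)}
    (hA : ∀ s ∈ A, ∃ x y : ℤ, |x| ≤ H₁ ∧ |y| ≤ H₂ ∧ a₁ * (x : ZMod p) + a₂ * (y : ZMod p) = s)
    (l : ZMod p) :
    ratioCount A l * p ≤
      16 * 48 ^ 4 * (H₁ * H₂) ^ 2 * (dualMultipliers a₁ a₂ H₁ H₂ l).card := by
  have hp : 0 < p := Nat.pos_of_ne_zero (NeZero.ne p)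
  have h3 := card_ratio_mul_card_sq_le A (bohr a₁ a₂ H₁ H₂ 48) (bohr a₁ a₂ H₁ H₂ 24) l
    (fun s hs t ht => by
      obtain ⟨x, y, hx, hy, rfl⟩ := hA s hs
      exact absRes_mul_le_of_mem_bohr (by norm_num) hx hy ht)
    (fun t ht t' ht' => sub_mem_bohr (q := 24) ht ht')
  have h4 := le_card_bohr_mul a₁ a₂ H₁ H₂ 48 (by norm_num) h₁ h₂
  have h5 : ratioCount A l ≤ (A.filter (fun s => l * s ∈ A)).card :=
    Finset.card_le_card (Finset.filter_subset_filter _ (Finset.erase_subset _ _))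
  set D := (bohr a₁ a₂ H₁ H₂ 48).card
  change _ ≤ 16 * p * (dualMultipliers a₁ a₂ H₁ H₂ l).card at h3
  have h6 : p * (ratioCount A l * p) ≤
      p * (16 * 48 ^ 4 * (H₁ * H₂) ^ 2 * (dualMultipliers a₁ a₂ H₁ H₂ l).card) := by
    calc p * (ratioCount A l * p) = ratioCount A l * p ^ 2 := by ring
      _ ≤ (A.filter (fun s => l * s ∈ A)).card * (D * (48 * H₁ * (48 * H₂))) ^ 2 := by gcongr
      _ = ((A.filter (fun s => l * s ∈ A)).card * D ^ 2) * (48 * H₁ * (48 * H₂)) ^ 2 := by ring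
      _ ≤ (16 * p * (dualMultipliers a₁ a₂ H₁ H₂ l).card) * (48 * H₁ * (48 * H₂)) ^ 2 := by
          gcongr
      _ = _ := by ring
  exact Nat.le_of_mul_le_mul_left h6 hp

lemma sum_ratioCount_sq_le_of_hasDualPlane {p : ℕ} [Fact p.Prime] {a₁ a₂ : ZMod p}
    (ha₁ : a₁ ≠ 0) (ha₂ : a₂ ≠ 0) {H₁ H₂ : ℕ} (h₁ : 0 < H₁) (h₁₂ : H₁ ≤ H₂)
    (hinj : ∀ x₁ x₂ y₁ y₂ : ℤ, |x₁| ≤ H₁ → |x₂| ≤ H₂ → |y₁| ≤ H₁ → |y₂| ≤ H₂ →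
      a₁ * (x₁ : ZMod p) + a₂ * (x₂ : ZMod p) = a₁ * (y₁ : ZMod p) + a₂ * (y₂ : ZMod p) →
      x₁ = y₁ ∧ x₂ = y₂) {A : Finset (ZMod p)}
    (hA : ∀ s ∈ A, ∃ x y : ℤ, |x| ≤ H₁ ∧ |y| ≤ H₂ ∧ a₁ * (x : ZMod p) + a₂ * (y : ZMod p) = s)
    (L : Finset (ZMod p)) (hL : ∀ l ∈ L, l ≠ 0 ∧ HasDualPlane a₁ a₂ H₁ H₂ l) :
    ∑ l ∈ L, (ratioCount A l : ℝ) ^ 2 ≤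
      2 * (250000 * ((H₁ : ℝ) * H₂) ^ 2) * (1 + Real.log p) := by
  refine sum_sq_le_of_card_level_le L (ratioCount A) p _ (fun l _ => ?_) (fun k => ?_)
  · exact (Finset.card_le_univ _).trans_eq (ZMod.card p)
  · have h := card_hasDualPlane_mul_le ha₁ ha₂ h₁ h₁₂ hinj (Nat.succ_pos k)
      (L.filter (fun l => k < ratioCount A l)) (fun l hl => by
        rw [Finset.mem_filter] at hl
        exact ⟨(hL l hl.1).1, (hL l hl.1).2,
          lt_of_le_of_lt hl.2 (ratioCount_lt_card_ratioLattice hA l)⟩)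
    have h' : (((L.filter (fun l => k < ratioCount A l)).card * (k + 1) ^ 2 : ℕ) : ℝ) ≤
        ((250000 * (H₁ * H₂) ^ 2 : ℕ) : ℝ) := Nat.cast_le.mpr h
    push_cast at h'
    exact h'

lemma sum_ratioCount_sq_le_of_not_hasDualPlane {p : ℕ} [Fact p.Prime] {a₁ a₂ : ZMod p}
    (ha₁ : a₁ ≠ 0) (ha₂ : a₂ ≠ 0) {H₁ H₂ : ℕ} (h₁ : 0 < H₁) (h₂ : 0 < H₂)
    {A : Finset (ZMod p)}
    (hA : ∀ s ∈ A, ∃ x y : ℤ, |x| ≤ H₁ ∧ |y| ≤ H₂ ∧ a₁ * (x : ZMod p) + a₂ * (y : ZMod p) = s)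
    (hcard : H₁ * H₂ ≤ A.card)
    (L : Finset (ZMod p)) (hL : ∀ l ∈ L, l ≠ 0 ∧ ¬ HasDualPlane a₁ a₂ H₁ H₂ l) :
    ∑ l ∈ L, (ratioCount A l : ℝ) ^ 2 ≤
      (16 * 48 ^ 4) ^ 2 * (2 * ((A.card : ℝ) ^ 4 / p) +
        576 * (A.card : ℝ) ^ 2 * (1 + Real.log p)) := by
  have hp : (0 : ℝ) < p := Nat.cast_pos.mpr (Fact.out : p.Prime).pos
  have hM : 0 < H₁ * H₂ := Nat.mul_pos h₁ h₂
  have hn : (0 : ℝ) < A.card := Nat.cast_pos.mpr (hM.trans_le hcard)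
  have hMn : (H₁ : ℝ) * H₂ ≤ A.card := by exact_mod_cast hcard
  have hM0 : (0 : ℝ) ≤ (H₁ : ℝ) * H₂ := by positivity
  have hlog : 0 ≤ Real.log p := Real.log_natCast_nonneg p
  have hN : A.card * (bohr a₁ a₂ H₁ H₂ 12).card ≤ 4 * p := by
    refine card_mul_card_le_of_absRes_le _ _ (fun s hs t ht => ?_)
    obtain ⟨x, y, hx, hy, rfl⟩ := hA s hs
    exact absRes_mul_le_of_mem_bohr le_rfl hx hy ht
  set r : ZMod p → ℕ := fun l => (dualMultipliers a₁ a₂ H₁ H₂ l).card with hr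
  have hf := sum_sq_le_of_card_level_le L (fun l => r l - 1) p (144 * (p : ℝ) ^ 2 / A.card ^ 2)
    (fun l _ => (Nat.sub_le _ _).trans ((Finset.card_le_univ _).trans_eq (ZMod.card p)))
    (fun k => by
      have h := card_not_hasDualPlane_mul_le ha₁ ha₂ h₁ A.card hN (Nat.succ_pos k)
        (L.filter (fun l => k < r l - 1)) (fun l hl => by
          rw [Finset.mem_filter] at hl
          exact ⟨(hL l hl.1).1, (hL l hl.1).2, Nat.add_lt_of_lt_sub hl.2⟩)
      have h' : (((L.filter (fun l => k < r l - 1)).card * (k + 1) ^ 2 * A.card ^ 2 : ℕ) : ℝ) ≤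
          ((144 * p ^ 2 : ℕ) : ℝ) := Nat.cast_le.mpr h
      push_cast at h'
      rwa [le_div_iff₀ (by positivity)])
  have hpt : ∀ l ∈ L, (ratioCount A l : ℝ) ^ 2 * p ^ 2 ≤
      (16 * 48 ^ 4) ^ 2 * ((H₁ : ℝ) * H₂) ^ 4 * (2 * ((r l - 1 : ℕ) : ℝ) ^ 2 + 2) := by
    intro l _
    have h : ((ratioCount A l * p : ℕ) : ℝ) ≤ ((16 * 48 ^ 4 * (H₁ * H₂) ^ 2 * r l : ℕ) : ℝ) :=
      Nat.cast_le.mpr (ratioCount_mul_le h₁ h₂ hA l)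
    rw [Nat.cast_mul, Nat.cast_mul _ (r l)] at h
    have h1 : (r l : ℝ) ≤ ((r l - 1 : ℕ) : ℝ) + 1 := by
      have : r l ≤ r l - 1 + 1 := by omega
      exact_mod_cast this
    have h2 : (r l : ℝ) ^ 2 ≤ 2 * ((r l - 1 : ℕ) : ℝ) ^ 2 + 2 := by
      have := pow_le_pow_left₀ (Nat.cast_nonneg (r l)) h1 2
      nlinarith [sq_nonneg (((r l - 1 : ℕ) : ℝ) - 1)]
    calc (ratioCount A l : ℝ) ^ 2 * p ^ 2 = (ratioCount A l * p : ℝ) ^ 2 := by ring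
      _ ≤ (((16 * 48 ^ 4 * (H₁ * H₂) ^ 2 : ℕ) : ℝ) * r l) ^ 2 :=
        pow_le_pow_left₀ (by positivity) h 2
      _ = (16 * 48 ^ 4) ^ 2 * ((H₁ : ℝ) * H₂) ^ 4 * (r l : ℝ) ^ 2 := by push_cast; ring
      _ ≤ _ := by gcongr
  have hLp : (L.card : ℝ) ≤ p :=
    Nat.cast_le.mpr ((Finset.card_le_univ _).trans_eq (ZMod.card p))
  have hsum : (∑ l ∈ L, (ratioCount A l : ℝ) ^ 2) * p ^ 2 ≤
      (16 * 48 ^ 4) ^ 2 * ((H₁ : ℝ) * H₂) ^ 4 *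
        (2 * (2 * (144 * (p : ℝ) ^ 2 / A.card ^ 2) * (1 + Real.log p)) + 2 * p) := by
    calc (∑ l ∈ L, (ratioCount A l : ℝ) ^ 2) * p ^ 2
        ≤ (16 * 48 ^ 4) ^ 2 * ((H₁ : ℝ) * H₂) ^ 4 *
          (2 * ∑ l ∈ L, ((r l - 1 : ℕ) : ℝ) ^ 2 + 2 * L.card) := by
          rw [Finset.sum_mul]
          refine (Finset.sum_le_sum hpt).trans_eq ?_
          rw [← Finset.mul_sum, Finset.sum_add_distrib, ← Finset.mul_sum, Finset.sum_const,
            nsmul_eq_mul]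
          ring
      _ ≤ _ := by gcongr
  have hfac : (16 * 48 ^ 4) ^ 2 * ((H₁ : ℝ) * H₂) ^ 4 *
        (2 * (2 * (144 * (p : ℝ) ^ 2 / A.card ^ 2) * (1 + Real.log p)) + 2 * p) ≤
      (16 * 48 ^ 4) ^ 2 * (A.card : ℝ) ^ 4 *
        (2 * (2 * (144 * (p : ℝ) ^ 2 / A.card ^ 2) * (1 + Real.log p)) + 2 * p) := by
    gcongr
  refine le_of_mul_le_mul_right ((hsum.trans hfac).trans_eq ?_) (show (0 : ℝ) < p ^ 2 by positivity)
  field_simp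
  ring

lemma multEnergy_le_of_le {p : ℕ} [Fact p.Prime] {a₁ a₂ : ZMod p}
    (ha₁ : a₁ ≠ 0) (ha₂ : a₂ ≠ 0) {H₁ H₂ : ℕ} (h₁ : 0 < H₁) (h₁₂ : H₁ ≤ H₂)
    (hinj : ∀ x₁ x₂ y₁ y₂ : ℤ, |x₁| ≤ H₁ → |x₂| ≤ H₂ → |y₁| ≤ H₁ → |y₂| ≤ H₂ →
      a₁ * (x₁ : ZMod p) + a₂ * (x₂ : ZMod p) = a₁ * (y₁ : ZMod p) + a₂ * (y₂ : ZMod p) →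
      x₁ = y₁ ∧ x₂ = y₂) {A : Finset (ZMod p)}
    (hA : ∀ s ∈ A, ∃ x y : ℤ, |x| ≤ H₁ ∧ |y| ≤ H₂ ∧ a₁ * (x : ZMod p) + a₂ * (y : ZMod p) = s)
    (hcard : H₁ * H₂ ≤ A.card) :
    (multEnergy A : ℝ) ≤ (3 * (576 * (16 * 48 ^ 4) ^ 2 + 500004)) *
      ((A.card : ℝ) ^ 2 + (A.card : ℝ) ^ 4 / p) * Real.log p := by
  classical
  have hE : (multEnergy A : ℝ) ≤ ((4 * A.card ^ 2 +
      ∑ l ∈ Finset.univ.filter (fun l : ZMod p => l ≠ 0), ratioCount A l ^ 2 : ℕ) : ℝ) :=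
    Nat.cast_le.mpr (multEnergy_le A)
  push_cast at hE
  rw [← Finset.sum_filter_add_sum_filter_not _ (HasDualPlane a₁ a₂ H₁ H₂)] at hE
  have hB := sum_ratioCount_sq_le_of_hasDualPlane ha₁ ha₂ h₁ h₁₂ hinj hA
    ((Finset.univ.filter (fun l : ZMod p => l ≠ 0)).filter (HasDualPlane a₁ a₂ H₁ H₂))
    (fun l hl => by simpa using hl)
  have hG := sum_ratioCount_sq_le_of_not_hasDualPlane ha₁ ha₂ h₁ (h₁.trans_le h₁₂) hA hcard
    ((Finset.univ.filter (fun l : ZMod p => l ≠ 0)).filter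
      (fun l => ¬ HasDualPlane a₁ a₂ H₁ H₂ l))
    (fun l hl => by simpa using hl)
  have hMn : ((H₁ : ℝ) * H₂) ^ 2 ≤ (A.card : ℝ) ^ 2 :=
    pow_le_pow_left₀ (by positivity) (by exact_mod_cast hcard) 2
  have hlog : 1 / 2 < Real.log p := by
    have h2 : Real.log 2 ≤ Real.log p :=
      Real.log_le_log two_pos (by exact_mod_cast (Fact.out : p.Prime).two_le)
    linarith [Real.log_two_gt_d9]
  set P : ℝ := (A.card : ℝ) ^ 2
  set Q : ℝ := (A.card : ℝ) ^ 4 / p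
  set T : ℝ := 1 + Real.log p with hT
  have hP : 0 ≤ P := by positivity
  have hQ : 0 ≤ Q := by positivity
  have hT1 : 1 ≤ T := by linarith
  have hT3 : T ≤ 3 * Real.log p := by linarith
  have hPT : P ≤ P * T := le_mul_of_one_le_right hP hT1
  have hQT : Q ≤ Q * T := le_mul_of_one_le_right hQ hT1
  have hMT : ((H₁ : ℝ) * H₂) ^ 2 * T ≤ P * T := by gcongr
  have hfin : (P + Q) * T ≤ (P + Q) * (3 * Real.log p) := by gcongr
  have hQT0 : 0 ≤ Q * T := hQ.trans hQT
  linarith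

/-- **Multiplicative energy of symmetric proper rank-2 GAPs.**
There is an absolute constant C > 0 such that for every prime p and every symmetric
proper rank-2 GAP A = {a₁x₁ + a₂x₂ : |x₁| ≤ H₁, |x₂| ≤ H₂} ⊆ F_p one has
E_×(A) ≤ C · (|A|² + |A|⁴/p) · log p. -/
theorem stmt3 :
    ∃ C : ℝ, 0 < C ∧
      ∀ (p : ℕ), p.Prime →
      ∀ (H₁ H₂ : ℕ), 0 < H₁ → 0 < H₂ →
      ∀ (a₁ a₂ : ZMod p), a₁ ≠ 0 → a₂ ≠ 0 →
      ∀ (A : Finset (ZMod p)),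
        A = ((Finset.Icc (-(H₁ : ℤ)) H₁) ×ˢ (Finset.Icc (-(H₂ : ℤ)) H₂)).image
              (fun x => a₁ * (x.1 : ZMod p) + a₂ * (x.2 : ZMod p)) →
        A.card = (2 * H₁ + 1) * (2 * H₂ + 1) →
        (multEnergy A : ℝ) ≤ C * ((A.card : ℝ) ^ 2 + (A.card : ℝ) ^ 4 / p) * Real.log p := by
  refine ⟨3 * (576 * (16 * 48 ^ 4) ^ 2 + 500004), by norm_num, ?_⟩
  intro p hp H₁ H₂ h₁ h₂ a₁ a₂ ha₁ ha₂ A hAeq hcard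
  have := Fact.mk hp
  have hA : ∀ s ∈ A, ∃ x y : ℤ, |x| ≤ H₁ ∧ |y| ≤ H₂ ∧
      a₁ * (x : ZMod p) + a₂ * (y : ZMod p) = s := by
    intro s hs
    rw [hAeq, Finset.mem_image] at hs
    obtain ⟨⟨x, y⟩, hxy, rfl⟩ := hs
    rw [Finset.mem_product, Finset.mem_Icc, Finset.mem_Icc] at hxy
    exact ⟨x, y, abs_le.mpr hxy.1, abs_le.mpr hxy.2, rfl⟩
  have hinj : ∀ x₁ x₂ y₁ y₂ : ℤ, |x₁| ≤ H₁ → |x₂| ≤ H₂ → |y₁| ≤ H₁ → |y₂| ≤ H₂ →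
      a₁ * (x₁ : ZMod p) + a₂ * (x₂ : ZMod p) = a₁ * (y₁ : ZMod p) + a₂ * (y₂ : ZMod p) →
      x₁ = y₁ ∧ x₂ = y₂ := by
    have hcard' : ((Finset.Icc (-(H₁ : ℤ)) H₁) ×ˢ (Finset.Icc (-(H₂ : ℤ)) H₂)).card =
        (2 * H₁ + 1) * (2 * H₂ + 1) := by
      rw [Finset.card_product, Int.card_Icc, Int.card_Icc]
      congr 1 <;> omega
    have hio := Finset.card_image_iff.mp ((hAeq ▸ hcard).trans hcard'.symm)
    intro x₁ x₂ y₁ y₂ hx₁ hx₂ hy₁ hy₂ h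
    have key := @hio (x₁, x₂)
      (Finset.mem_coe.mpr (Finset.mem_product.mpr
        ⟨Finset.mem_Icc.mpr (abs_le.mp hx₁), Finset.mem_Icc.mpr (abs_le.mp hx₂)⟩)) (y₁, y₂)
      (Finset.mem_coe.mpr (Finset.mem_product.mpr
        ⟨Finset.mem_Icc.mpr (abs_le.mp hy₁), Finset.mem_Icc.mpr (abs_le.mp hy₂)⟩)) h
    exact Prod.mk.inj key
  have hle : H₁ * H₂ ≤ A.card := hcard ▸ Nat.mul_le_mul (by omega) (by omega)
  rcases le_total H₁ H₂ with h | h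
  · exact multEnergy_le_of_le ha₁ ha₂ h₁ h hinj hA hle
  · refine multEnergy_le_of_le ha₂ ha₁ h₂ h ?_ ?_ ((mul_comm _ _).trans_le hle)
    · intro x₁ x₂ y₁ y₂ hx₁ hx₂ hy₁ hy₂ hxy
      exact (hinj x₂ x₁ y₂ y₁ hx₂ hx₁ hy₂ hy₁ (by rw [add_comm, hxy, add_comm])).symm
    · intro s hs
      obtain ⟨x, y, hx, hy, rfl⟩ := hA s hs
      exact ⟨y, x, hy, hx, add_comm _ _⟩
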